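/- Let n ≥ 4. A map Z : P_o^n → K_o^n is an SL(n) covariant Minkowski valuation (i.e., an L₁ Minkowski valuation) if and only if there exist constants c₁, c₂, c₃, c₄ ≥ 0 such that ZP = c₁·M⁺P + c₂·M⁻P + c₃·P + c₄·(−P) for every P ∈ P_o^n, where + is ordinary Minkowski addition. -/

import Mathlib

open scoped RealInnerProductSpace BigOperators Pointwise ENNReal
open MeasureTheory Filter Matrix

noncomputable section

/-- `Euc n` is Euclidean space `ℝ^n`. -/
abbrev Euc (n : ℕ) := EuclideanSpace ℝ (Fin n)

/-- A convex body in `ℝ^n` containing the origin: a nonempty compact convex set with `0 ∈ K`. -/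
def IsConvexBody0 {n : ℕ} (K : Set (Euc n)) : Prop :=
  IsCompact K ∧ Convex ℝ K ∧ (0 : Euc n) ∈ K

/-- A convex polytope in `ℝ^n` containing the origin. -/
def IsPolytope0 {n : ℕ} (P : Set (Euc n)) : Prop :=
  (∃ S : Finset (Euc n), P = convexHull ℝ (S : Set (Euc n))) ∧ (0 : Euc n) ∈ P

/-- The support function `h_K(x) = sup { ⟪x, y⟫ : y ∈ K }`. -/
def supp {n : ℕ} (K : Set (Euc n)) (x : Euc n) : ℝ :=
  sSup ((fun y => ⟪x, y⟫) '' K)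

/-- The image of a set under the linear map induced by a matrix. -/
def matAct {n : ℕ} (A : Matrix (Fin n) (Fin n) ℝ) (K : Set (Euc n)) : Set (Euc n) :=
  (Matrix.toEuclideanLin A) '' K

/-- The vector `A x`. -/
def matVec {n : ℕ} (A : Matrix (Fin n) (Fin n) ℝ) (x : Euc n) : Euc n :=
  Matrix.toEuclideanLin A x

/-- The dimension of a set: the dimension of (the direction of) its affine hull. -/
def sdim {n : ℕ} (P : Set (Euc n)) : ℕ :=
  Module.finrank ℝ (affineSpan ℝ P).direction

/-- Support function of the asymmetric moment body: `h_{M⁺K}(x) = ∫_K max(⟪x,y⟫,0) dy`. -/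
def mPlus1 {n : ℕ} (K : Set (Euc n)) (x : Euc n) : ℝ :=
  ∫ y in K, max ⟪x, y⟫ 0

/-- Support function of the asymmetric moment body `M⁻`. -/
def mMinus1 {n : ℕ} (K : Set (Euc n)) (x : Euc n) : ℝ :=
  ∫ y in K, max (-⟪x, y⟫) 0

/-- `Z` is `SL(n)` covariant on polytopes containing the origin. -/
def SLCovariant {n : ℕ} (Z : Set (Euc n) → Set (Euc n)) : Prop :=
  ∀ (φ : Matrix.SpecialLinearGroup (Fin n) ℝ) (P : Set (Euc n)), IsPolytope0 P →
    Z (matAct (φ : Matrix (Fin n) (Fin n) ℝ) P) = matAct (φ : Matrix (Fin n) (Fin n) ℝ) (Z P)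

/-- `Z` is a Minkowski valuation (with ordinary Minkowski addition of sets). -/
def ValuationMink {n : ℕ} (Z : Set (Euc n) → Set (Euc n)) : Prop :=
  ∀ K L : Set (Euc n), IsPolytope0 K → IsPolytope0 L → IsPolytope0 (K ∪ L) →
    IsPolytope0 (K ∩ L) → Z (K ∪ L) + Z (K ∩ L) = Z K + Z L

namespace MinkowskiClassification

variable {n : ℕ}

/-- The convex hull of the origin and the vectors `v i` with `i ∈ I`. -/
def hullZero {ι : Type*} (v : ι → Euc n) (I : Finset ι) : Set (Euc n) :=
  convexHull ℝ (insert 0 (v '' I))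

lemma isPolytope0_convexHull {S : Set (Euc n)} (hS : S.Finite) (h0 : (0 : Euc n) ∈ convexHull ℝ S) :
    IsPolytope0 (convexHull ℝ S) :=
  ⟨⟨hS.toFinset, by simp⟩, h0⟩

lemma isPolytope0_hullZero {ι : Type*} (v : ι → Euc n) (I : Finset ι) :
    IsPolytope0 (hullZero v I) :=
  isPolytope0_convexHull ((I.finite_toSet.image v).insert 0)
    (subset_convexHull ℝ _ (Set.mem_insert _ _))

lemma mem_hullZero {ι : Type*} [Fintype ι] {v : ι → Euc n} {I : Finset ι} {z : Euc n} :
    z ∈ hullZero v I ↔ ∃ c : ι → ℝ, (∀ i, 0 ≤ c i) ∧ (∀ i, i ∉ I → c i = 0) ∧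
      ∑ i, c i ≤ 1 ∧ ∑ i, c i • v i = z := by
  classical
  constructor
  · intro hz
    have hconv : Convex ℝ {z : Euc n | ∃ c : ι → ℝ, (∀ i, 0 ≤ c i) ∧ (∀ i, i ∉ I → c i = 0) ∧
      ∑ i, c i ≤ 1 ∧ ∑ i, c i • v i = z} := by
      rintro x ⟨c, hc0, hcI, hc1, rfl⟩ y ⟨d, hd0, hdI, hd1, rfl⟩ a b ha hb hab
      refine ⟨fun i => a * c i + b * d i, fun i => by have := hc0 i; have := hd0 i; positivity,
        fun i hi => by simp [hcI i hi, hdI i hi], ?_, ?_⟩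
      · rw [Finset.sum_add_distrib, ← Finset.mul_sum, ← Finset.mul_sum]
        nlinarith
      · simp only [add_smul, mul_smul, Finset.sum_add_distrib, Finset.smul_sum]
    refine convexHull_min ?_ hconv hz
    rintro y (rfl | ⟨i, hi, rfl⟩)
    · exact ⟨0, by simp⟩
    · refine ⟨Pi.single i 1, fun j => ?_, fun j hj => ?_, ?_, ?_⟩
      · by_cases h : j = i
        · subst h; simp
        · simp [h]
      · have : j ≠ i := by rintro rfl; exact hj hi
        simp [this]
      · simp
      · rw [Finset.sum_eq_single i]
        · simp
        · intro j _ hj; simp [hj]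
        · simp
  · rintro ⟨c, hc0, hcI, hc1, rfl⟩
    have key := (convex_convexHull ℝ (insert (0 : Euc n) (v '' I))).sum_mem
      (t := (Finset.univ : Finset (Option ι)))
      (w := fun o => o.elim (1 - ∑ i, c i) c)
      (z := fun o => o.elim 0 (fun i => if i ∈ I then v i else 0)) ?_ ?_ ?_
    · have e : ∑ i, c i • v i = ∑ i, c i • (if i ∈ I then v i else 0) := by
        refine Finset.sum_congr rfl fun i _ => ?_
        split_ifs with h
        · rfl
        · simp [hcI i h]
      rw [Fintype.sum_option] at key
      simpa [hullZero, e] using key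
    · rintro (_ | i) _
      · simpa using hc1
      · exact hc0 i
    · simp [Fintype.sum_option]
    · rintro (_ | i) _
      · exact subset_convexHull ℝ _ (Set.mem_insert _ _)
      · apply subset_convexHull ℝ _
        by_cases h : i ∈ I
        · right; exact ⟨i, h, by simp [h]⟩
        · left; simp [h]

lemma image_hullZero {ι : Type*} (f : Euc n →ₗ[ℝ] Euc n) (v : ι → Euc n) (I : Finset ι) :
    f '' hullZero v I = hullZero (f ∘ v) I := by
  rw [hullZero, hullZero, LinearMap.image_convexHull, Set.image_insert_eq, map_zero,
    Set.image_comp]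

lemma hullZero_congr {ι : Type*} {v w : ι → Euc n} {I : Finset ι} (h : ∀ i ∈ I, v i = w i) :
    hullZero v I = hullZero w I := by
  rw [hullZero, hullZero, Set.image_congr (fun i hi => h i hi)]

lemma hullZero_comp {ι κ : Type*} (v : ι → Euc n) (e : κ ↪ ι) (I : Finset κ) :
    hullZero (v ∘ e) I = hullZero v (I.map e) := by
  rw [hullZero, hullZero, Finset.coe_map, Set.image_comp]

/-- The signed volume of the parallelepiped spanned by a family of `n` vectors. -/
def vol (n : ℕ) : (Euc n) [⋀^Fin n]→ₗ[ℝ] ℝ :=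
  (EuclideanSpace.basisFun (Fin n) ℝ).toBasis.det

/-- A family of vectors with nonzero volume, viewed as a basis. -/
def basisOfVol {u : Fin n → Euc n} (hu : vol n u ≠ 0) : Module.Basis (Fin n) ℝ (Euc n) :=
  Module.Basis.mk ((Module.Basis.is_basis_iff_det _).mpr (isUnit_iff_ne_zero.mpr hu)).1
    ((Module.Basis.is_basis_iff_det _).mpr (isUnit_iff_ne_zero.mpr hu)).2.ge

@[simp] lemma coe_basisOfVol {u : Fin n → Euc n} (hu : vol n u ≠ 0) :
    ⇑(basisOfVol hu) = u := Module.Basis.coe_mk _ _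

lemma vol_ne_zero_of_linearIndependent {u : Fin n → Euc n} (hu : LinearIndependent ℝ u) :
    vol n u ≠ 0 := by
  have hs : Submodule.span ℝ (Set.range u) = ⊤ :=
    hu.span_eq_top_of_card_eq_finrank' (by simp)
  exact isUnit_iff_ne_zero.mp ((Module.Basis.is_basis_iff_det _).mp ⟨hu, hs⟩)

lemma vol_std : vol n (EuclideanSpace.basisFun (Fin n) ℝ) = 1 := by
  have := (EuclideanSpace.basisFun (Fin n) ℝ).toBasis.det_self
  simpa [vol] using this

lemma ext_inner_of_vol {u : Fin n → Euc n} (hu : vol n u ≠ 0) {x y : Euc n}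
    (h : ∀ i, ⟪x, u i⟫ = ⟪y, u i⟫) : x = y := by
  exact InnerProductSpace.ext_inner_right_basis (basisOfVol hu) fun i => by simpa using h i

/-- Prescribing the inner products with a basis. -/
lemma exists_inner_eq {u : Fin n → Euc n} (hu : vol n u ≠ 0) (a : Fin n → ℝ) :
    ∃ x : Euc n, ∀ i, ⟪x, u i⟫ = a i := by
  refine ⟨(InnerProductSpace.toDual ℝ (Euc n)).symm
    (LinearMap.toContinuousLinearMap ((basisOfVol hu).constr ℝ a)), fun i => ?_⟩
  have : u i = basisOfVol hu i := by simp
  rw [InnerProductSpace.toDual_symm_apply, LinearMap.coe_toContinuousLinearMap', this,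
    Module.Basis.constr_basis]

/-- The functionals to which the classification applies: pointwise valuations that are
`SL(n)` covariant, continuous and positively homogeneous in the direction. -/
structure Admissible (g : Set (Euc n) → Euc n → ℝ) : Prop where
  val : ∀ K L : Set (Euc n), IsPolytope0 K → IsPolytope0 L → IsPolytope0 (K ∪ L) →
    IsPolytope0 (K ∩ L) → ∀ x, g (K ∪ L) x + g (K ∩ L) x = g K x + g L x
  cov : ∀ f : Euc n →ₗ[ℝ] Euc n, LinearMap.det f = 1 → ∀ P, IsPolytope0 P → ∀ x,
    g (f '' P) x = g P (LinearMap.adjoint f x)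
  cont : ∀ P, IsPolytope0 P → Continuous (g P)
  hom : ∀ P, IsPolytope0 P → ∀ t : ℝ, 0 ≤ t → ∀ x, g P (t • x) = t * g P x

lemma Admissible.add {g g' : Set (Euc n) → Euc n → ℝ} (hg : Admissible g) (hg' : Admissible g') :
    Admissible (fun P x => g P x + g' P x) where
  val K L hK hL hU hI x := by
    have := hg.val K L hK hL hU hI x
    have := hg'.val K L hK hL hU hI x
    linarith
  cov f hf P hP x := by simp [hg.cov f hf P hP x, hg'.cov f hf P hP x]
  cont P hP := (hg.cont P hP).add (hg'.cont P hP)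
  hom P hP t ht x := by simp [hg.hom P hP t ht x, hg'.hom P hP t ht x, mul_add]

lemma Admissible.const_mul {g : Set (Euc n) → Euc n → ℝ} (hg : Admissible g) (c : ℝ) :
    Admissible (fun P x => c * g P x) where
  val K L hK hL hU hI x := by
    rw [← mul_add, ← mul_add, hg.val K L hK hL hU hI x]
  cov f hf P hP x := by simp [hg.cov f hf P hP x]
  cont P hP := (hg.cont P hP).const_mul c
  hom P hP t ht x := by simp only [hg.hom P hP t ht x]; ring

lemma Admissible.comp_neg {g : Set (Euc n) → Euc n → ℝ} (hg : Admissible g) :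
    Admissible (fun P x => g P (-x)) where
  val K L hK hL hU hI x := hg.val K L hK hL hU hI (-x)
  cov f hf P hP x := by simp [hg.cov f hf P hP]
  cont P hP := (hg.cont P hP).comp continuous_neg
  hom P hP t ht x := by simp only [← smul_neg, hg.hom P hP t ht]

lemma Admissible.eq_of_vol_eq {g : Set (Euc n) → Euc n → ℝ} (hg : Admissible g)
    {u v : Fin n → Euc n} (hu : vol n u ≠ 0) (huv : vol n u = vol n v) {x y : Euc n}
    (hxy : ∀ i, ⟪x, u i⟫ = ⟪y, v i⟫) (I : Finset (Fin n)) :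
    g (hullZero u I) x = g (hullZero v I) y := by
  set f : Euc n →ₗ[ℝ] Euc n := (basisOfVol hu).constr ℝ v with hf
  have hfu : f ∘ u = v := by
    funext i
    have : u i = basisOfVol hu i := by simp
    rw [Function.comp_apply, this, hf, Module.Basis.constr_basis]
  have hdet : LinearMap.det f = 1 := by
    have := (EuclideanSpace.basisFun (Fin n) ℝ).toBasis.det_comp f u
    rw [hfu] at this
    change vol n v = _ * vol n u at this
    rw [← huv] at this
    exact (mul_right_cancel₀ hu (by rw [one_mul]; exact this)).symm
  have hx : LinearMap.adjoint f y = x := by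
    refine ext_inner_of_vol hu fun i => ?_
    rw [LinearMap.adjoint_inner_left, hxy i, ← hfu, Function.comp_apply]
  rw [← hfu, ← image_hullZero, hg.cov f hdet _ (isPolytope0_hullZero u I), hx]

lemma sum_smul_update {ι : Type*} [Fintype ι] [DecidableEq ι] (u : ι → Euc n) (j : ι) (w : Euc n)
    (c : ι → ℝ) :
    ∑ k, c k • Function.update u j w k = ∑ k, c k • u k + c j • (w - u j) := by
  have h : ∀ k, c k • Function.update u j w k
      = c k • u k + (if k = j then c k • (w - u j) else 0) := by
    intro k
    by_cases hk : k = j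
    · subst hk; simp [smul_sub]
    · simp [hk]
  simp [h, Finset.sum_add_distrib]

lemma sum_smul_add_single_sub {ι : Type*} [Fintype ι] [DecidableEq ι] (u : ι → Euc n) (i j : ι)
    (c : ι → ℝ) (s : ℝ) :
    ∑ k, (c k + s * ((Pi.single i 1 : ι → ℝ) k - (Pi.single j 1 : ι → ℝ) k)) • u k
      = ∑ k, c k • u k + s • (u i - u j) := by
  simp [add_smul, mul_smul, sub_smul, Finset.sum_add_distrib, Pi.single_apply, ite_smul,
    Finset.sum_sub_distrib, smul_sub]

lemma sum_add_single_sub {ι : Type*} [Fintype ι] [DecidableEq ι] (i j : ι)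
    (c : ι → ℝ) (s : ℝ) :
    ∑ k, (c k + s * ((Pi.single i 1 : ι → ℝ) k - (Pi.single j 1 : ι → ℝ) k)) = ∑ k, c k := by
  simp [Finset.sum_add_distrib, ← Finset.mul_sum]

lemma mem_hullZero_update {ι : Type*} [Fintype ι] [DecidableEq ι] {u : ι → Euc n} {I : Finset ι}
    {i j : ι} (hi : i ∈ I) (hj : j ∈ I) (hij : i ≠ j) {t : ℝ} (ht0 : 0 < t) (ht1 : t < 1)
    {z : Euc n} :
    z ∈ hullZero (Function.update u j (t • u i + (1 - t) • u j)) I ↔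
      ∃ c : ι → ℝ, (∀ i, 0 ≤ c i) ∧ (∀ i, i ∉ I → c i = 0) ∧ ∑ i, c i ≤ 1 ∧
        t * c j ≤ (1 - t) * c i ∧ ∑ i, c i • u i = z := by
  have ht : 0 < 1 - t := by linarith
  rw [mem_hullZero]
  constructor
  · rintro ⟨c, h0, hI, h1, rfl⟩
    refine ⟨fun k => c k + (t * c j) * ((Pi.single i 1 : ι → ℝ) k - (Pi.single j 1 : ι → ℝ) k),
      ?_, ?_, ?_, ?_, ?_⟩
    · intro k
      have := h0 k
      have := h0 j
      by_cases hki : k = i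
      · subst hki; simp [hij]; positivity
      · by_cases hkj : k = j
        · subst hkj; simp [hki]; nlinarith
        · simp [hki, hkj]; exact h0 k
    · intro k hk
      have h1 : k ≠ i := by rintro rfl; exact hk hi
      have h2 : k ≠ j := by rintro rfl; exact hk hj
      simp [h1, h2, hI k hk]
    · rw [sum_add_single_sub]; exact h1
    · have := h0 i
      simp [hij, hij.symm]
      nlinarith [mul_nonneg ht.le this]
    · rw [sum_smul_add_single_sub, sum_smul_update]
      congr 1
      module
  · rintro ⟨c, h0, hI, h1, hc, rfl⟩
    refine ⟨fun k => c k + (t * c j / (1 - t)) * ((Pi.single j 1 : ι → ℝ) k - (Pi.single i 1 : ι → ℝ) k),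
      ?_, ?_, ?_, ?_⟩
    · intro k
      have := h0 k
      have := h0 j
      by_cases hki : k = i
      · subst hki
        simp only [Pi.single_eq_same, Pi.single_eq_of_ne hij]
        have : t * c j / (1 - t) ≤ c k := by rw [div_le_iff₀ ht]; linarith
        linarith
      · by_cases hkj : k = j
        · subst hkj; simp [hki]; positivity
        · simp [hki, hkj]; exact h0 k
    · intro k hk
      have h1 : k ≠ i := by rintro rfl; exact hk hi
      have h2 : k ≠ j := by rintro rfl; exact hk hj
      simp [h1, h2, hI k hk]
    · rw [sum_add_single_sub]; exact h1
    · rw [sum_smul_update, sum_smul_add_single_sub]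
      simp only [Pi.single_eq_same, Pi.single_eq_of_ne hij.symm]
      have e : c j + t * c j / (1 - t) * (1 - 0) = c j / (1 - t) := by field_simp; ring
      have e2 : t * c j / (1 - t) = t * (c j / (1 - t)) := by ring
      rw [e, e2]
      module

lemma mem_hullZero_update' {ι : Type*} [Fintype ι] [DecidableEq ι] {u : ι → Euc n} {I : Finset ι}
    {i j : ι} (hi : i ∈ I) (hj : j ∈ I) (hij : i ≠ j) {t : ℝ} (ht0 : 0 < t) (ht1 : t < 1)
    {z : Euc n} :
    z ∈ hullZero (Function.update u i (t • u i + (1 - t) • u j)) I ↔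
      ∃ c : ι → ℝ, (∀ i, 0 ≤ c i) ∧ (∀ i, i ∉ I → c i = 0) ∧ ∑ i, c i ≤ 1 ∧
        (1 - t) * c i ≤ t * c j ∧ ∑ i, c i • u i = z := by
  have h := mem_hullZero_update (u := u) (z := z) hj hi hij.symm (t := 1 - t) (by linarith)
    (by linarith)
  rwa [sub_sub_cancel, add_comm] at h

lemma mem_hullZero_update_erase {ι : Type*} [Fintype ι] [DecidableEq ι] {u : ι → Euc n}
    {I : Finset ι} {i j : ι} (hi : i ∈ I) (hj : j ∈ I) (hij : i ≠ j) {t : ℝ} (ht0 : 0 < t)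
    (ht1 : t < 1) {z : Euc n} :
    z ∈ hullZero (Function.update u i (t • u i + (1 - t) • u j)) (I.erase j) ↔
      ∃ c : ι → ℝ, (∀ i, 0 ≤ c i) ∧ (∀ i, i ∉ I → c i = 0) ∧ ∑ i, c i ≤ 1 ∧
        t * c j = (1 - t) * c i ∧ ∑ i, c i • u i = z := by
  have ht : 0 < 1 - t := by linarith
  rw [mem_hullZero]
  constructor
  · rintro ⟨c, h0, hI, h1, rfl⟩
    have hcj : c j = 0 := hI j (by simp)
    refine ⟨fun k => c k + ((1 - t) * c i) * ((Pi.single j 1 : ι → ℝ) k - (Pi.single i 1 : ι → ℝ) k),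
      ?_, ?_, ?_, ?_, ?_⟩
    · intro k
      have := h0 k
      have := h0 i
      by_cases hki : k = i
      · subst hki; simp [hij]; nlinarith
      · by_cases hkj : k = j
        · subst hkj; simp [hki]; nlinarith [mul_nonneg ht.le this]
        · simp [hki, hkj]; exact h0 k
    · intro k hk
      have h1 : k ≠ i := by rintro rfl; exact hk hi
      have h2 : k ≠ j := by rintro rfl; exact hk hj
      simp [h1, h2, hI k (fun h => hk (Finset.mem_of_mem_erase h))]
    · rw [sum_add_single_sub]; exact h1
    · simp [hij, hij.symm, hcj]
      ring
    · rw [sum_smul_add_single_sub, sum_smul_update]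
      congr 1
      module
  · rintro ⟨c, h0, hI, h1, hc, rfl⟩
    refine ⟨fun k => c k + c j * ((Pi.single i 1 : ι → ℝ) k - (Pi.single j 1 : ι → ℝ) k),
      ?_, ?_, ?_, ?_⟩
    · intro k
      have := h0 k
      have := h0 j
      by_cases hki : k = i
      · subst hki; simp [hij]; positivity
      · by_cases hkj : k = j
        · subst hkj; simp [hki]
        · simp [hki, hkj]; exact h0 k
    · intro k hk
      by_cases h2 : k = j
      · subst h2; simp [hij.symm]
      have hk' : k ∉ I := fun h => hk (Finset.mem_erase.mpr ⟨h2, h⟩)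
      have h1 : k ≠ i := by rintro rfl; exact hk' hi
      simp [h1, h2, hI k hk']
    · rw [sum_add_single_sub]; exact h1
    · rw [sum_smul_update, sum_smul_add_single_sub]
      simp only [Pi.single_eq_same, Pi.single_eq_of_ne hij]
      have e : c j * (1 - t) = (c i + c j * (1 - 0)) * (1 - t) - (1 - t) * c i := by ring
      have e3 : (c i + c j * (1 - 0)) * (1 - t) = c j := by linarith
      have e4 : t • u i + (1 - t) • u j - u i = (1 - t) • (u j - u i) := by module
      rw [e4, smul_smul, e3]
      module

lemma hullZero_update_union {ι : Type*} [Fintype ι] [DecidableEq ι] {u : ι → Euc n} {I : Finset ι}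
    {i j : ι} (hi : i ∈ I) (hj : j ∈ I) (hij : i ≠ j) {t : ℝ} (ht0 : 0 < t) (ht1 : t < 1) :
    hullZero (Function.update u j (t • u i + (1 - t) • u j)) I ∪
      hullZero (Function.update u i (t • u i + (1 - t) • u j)) I = hullZero u I := by
  ext z
  rw [Set.mem_union, mem_hullZero_update hi hj hij ht0 ht1, mem_hullZero_update' hi hj hij ht0 ht1,
    mem_hullZero]
  constructor
  · rintro (⟨c, h0, hI, h1, -, h⟩ | ⟨c, h0, hI, h1, -, h⟩) <;> exact ⟨c, h0, hI, h1, h⟩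
  · rintro ⟨c, h0, hI, h1, h⟩
    rcases le_total (t * c j) ((1 - t) * c i) with hc | hc
    · exact Or.inl ⟨c, h0, hI, h1, hc, h⟩
    · exact Or.inr ⟨c, h0, hI, h1, hc, h⟩

lemma coeff_unique {u : Fin n → Euc n} (hu : vol n u ≠ 0) {c d : Fin n → ℝ}
    (h : ∑ i, c i • u i = ∑ i, d i • u i) : c = d := by
  have hli : LinearIndependent ℝ u := by simpa using (basisOfVol hu).linearIndependent
  rw [Fintype.linearIndependent_iff] at hli
  funext i
  have := hli (fun i => c i - d i) (by simp [sub_smul, Finset.sum_sub_distrib, h]) i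
  linarith

lemma hullZero_update_inter {u : Fin n → Euc n} (hu : vol n u ≠ 0) {I : Finset (Fin n)}
    {i j : Fin n} (hi : i ∈ I) (hj : j ∈ I) (hij : i ≠ j) {t : ℝ} (ht0 : 0 < t) (ht1 : t < 1) :
    hullZero (Function.update u j (t • u i + (1 - t) • u j)) I ∩
      hullZero (Function.update u i (t • u i + (1 - t) • u j)) I =
      hullZero (Function.update u i (t • u i + (1 - t) • u j)) (I.erase j) := by
  ext z
  rw [Set.mem_inter_iff, mem_hullZero_update hi hj hij ht0 ht1,
    mem_hullZero_update' hi hj hij ht0 ht1, mem_hullZero_update_erase hi hj hij ht0 ht1]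
  constructor
  · rintro ⟨⟨c, h0, hI, h1, hc, h⟩, ⟨d, -, -, -, hd, h'⟩⟩
    obtain rfl := coeff_unique hu (h.trans h'.symm)
    exact ⟨c, h0, hI, h1, le_antisymm hc hd, h⟩
  · rintro ⟨c, h0, hI, h1, hc, h⟩
    exact ⟨⟨c, h0, hI, h1, hc.le, h⟩, ⟨c, h0, hI, h1, hc.ge, h⟩⟩

lemma Admissible.cut {g : Set (Euc n) → Euc n → ℝ} (hg : Admissible g)
    {u : Fin n → Euc n} (hu : vol n u ≠ 0) {I : Finset (Fin n)}
    {i j : Fin n} (hi : i ∈ I) (hj : j ∈ I) (hij : i ≠ j) {t : ℝ} (ht0 : 0 < t) (ht1 : t < 1)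
    (x : Euc n) :
    g (hullZero u I) x
      + g (hullZero (Function.update u i (t • u i + (1 - t) • u j)) (I.erase j)) x
      = g (hullZero (Function.update u j (t • u i + (1 - t) • u j)) I) x
      + g (hullZero (Function.update u i (t • u i + (1 - t) • u j)) I) x := by
  have h := hg.val _ _
    (isPolytope0_hullZero (Function.update u j (t • u i + (1 - t) • u j)) I)
    (isPolytope0_hullZero (Function.update u i (t • u i + (1 - t) • u j)) I)
    (by rw [hullZero_update_union hi hj hij ht0 ht1]; exact isPolytope0_hullZero _ _)
    (by rw [hullZero_update_inter hu hi hj hij ht0 ht1]; exact isPolytope0_hullZero _ _) x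
  rwa [hullZero_update_union hi hj hij ht0 ht1, hullZero_update_inter hu hi hj hij ht0 ht1] at h

lemma vol_update_left (u : Fin n → Euc n) {i j : Fin n} (hij : i ≠ j) (s t : ℝ) :
    vol n (Function.update u i (s • u i + t • u j)) = s * vol n u := by
  rw [AlternatingMap.map_update_add, AlternatingMap.map_update_smul, AlternatingMap.map_update_smul,
    AlternatingMap.map_update_self _ _ hij, Function.update_eq_self]
  simp

lemma vol_update_right (u : Fin n → Euc n) {i j : Fin n} (hij : i ≠ j) (s t : ℝ) :
    vol n (Function.update u j (s • u i + t • u j)) = t * vol n u := by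
  rw [add_comm, vol_update_left u hij.symm]

lemma vol_update_smul (u : Fin n → Euc n) (i : Fin n) (s : ℝ) :
    vol n (Function.update u i (s • u i)) = s * vol n u := by
  rw [AlternatingMap.map_update_smul, Function.update_eq_self, smul_eq_mul]

/-- A basis can be modified outside `I` so that the new vectors are orthogonal to `x`. -/
lemma exists_orthogonal_outside {u : Fin n → Euc n} (hu : vol n u ≠ 0) {I : Finset (Fin n)}
    {i : Fin n} (hi : i ∈ I) {x : Euc n} (hx : ⟪x, u i⟫ ≠ 0) :
    ∃ v : Fin n → Euc n, vol n v ≠ 0 ∧ (∀ k ∈ I, v k = u k) ∧ ∀ k, k ∉ I → ⟪x, v k⟫ = 0 := by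
  classical
  set φ : Euc n →ₗ[ℝ] ℝ := (basisOfVol hu).constr ℝ
    (fun k => if k ∈ I then 0 else ⟪x, u k⟫ / ⟪x, u i⟫) with hφ
  have hφu : ∀ k, φ (u k) = if k ∈ I then 0 else ⟪x, u k⟫ / ⟪x, u i⟫ := by
    intro k
    have : u k = basisOfVol hu k := by simp
    rw [this, hφ, Module.Basis.constr_basis]
    simp
  set f : Euc n →ₗ[ℝ] Euc n := LinearMap.id - φ.smulRight (u i) with hf
  have hfz : ∀ z, f z = z - φ z • u i := fun z => by simp [hf]
  have hker : LinearMap.ker f = ⊥ := by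
    rw [LinearMap.ker_eq_bot']
    intro z hz
    rw [hfz, sub_eq_zero] at hz
    have : φ z = 0 := by
      conv_lhs => rw [hz]
      simp [hφu, hi]
    rw [hz, this, zero_smul]
  have hli : LinearIndependent ℝ u := by simpa using (basisOfVol hu).linearIndependent
  refine ⟨f ∘ u, vol_ne_zero_of_linearIndependent (hli.map' f hker), ?_, ?_⟩
  · intro k hk
    simp [hfz, hφu, hk]
  · intro k hk
    simp only [Function.comp_apply, hfz, hφu, hk, if_false, inner_sub_right, inner_smul_right]
    field_simp
    ring

lemma Admissible.hullZero_empty {g : Set (Euc n) → Euc n → ℝ} (hg : Admissible g) (hn : 2 ≤ n)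
    (u : Fin n → Euc n) (x : Euc n) : g (hullZero u ∅) x = 0 := by
  have he : ∀ v : Fin n → Euc n, hullZero v ∅ = hullZero u ∅ := fun v =>
    hullZero_congr (by simp)
  by_cases hx : x = 0
  · have := hg.hom _ (isPolytope0_hullZero u ∅) 0 le_rfl x
    simpa [hx] using this
  have hb : vol n (EuclideanSpace.basisFun (Fin n) ℝ) ≠ 0 := by rw [vol_std]; norm_num
  obtain ⟨i, hi⟩ : ∃ i, ⟪x, EuclideanSpace.basisFun (Fin n) ℝ i⟫ ≠ 0 := by
    by_contra! h
    exact hx (ext_inner_of_vol hb (fun i => by rw [h i, inner_zero_left]))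
  obtain ⟨v, hv, -, hv0⟩ := exists_orthogonal_outside hb (Finset.mem_singleton_self i) hi
  obtain ⟨j, hj⟩ : ∃ j : Fin n, j ≠ i := by
    have : Nontrivial (Fin n) := Fin.nontrivial_iff_two_le.mpr hn
    exact exists_ne i
  set w := Function.update v i ((2 : ℝ) • v i) with hw
  have hvol : vol n v = vol n (Function.update w j ((1 / 2 : ℝ) • w j)) := by
    rw [vol_update_smul, hw, vol_update_smul]; ring
  have := hg.eq_of_vol_eq hv hvol (x := (2 : ℝ) • x) (y := x) (fun k => by
    rw [inner_smul_left]
    by_cases hkj : k = j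
    · subst hkj
      simp [hw, hj, inner_smul_right, hv0 k (by simpa using hj)]
    · by_cases hki : k = i
      · subst hki
        simp [hw, hkj, inner_smul_right]
      · simp [hw, hkj, hki, hv0 k (by simpa using hki)]) ∅
  rw [he v, he (Function.update w j ((1 / 2 : ℝ) • w j)), hg.hom _ (isPolytope0_hullZero u ∅) 2 (by norm_num)] at this
  linarith

lemma Admissible.eq_of_inner_eq {g : Set (Euc n) → Euc n → ℝ} (hg : Admissible g) (hn : 2 ≤ n)
    {u v : Fin n → Euc n} (hu : vol n u ≠ 0) (hv : vol n v ≠ 0) {I : Finset (Fin n)}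
    (hI : I ≠ Finset.univ) {x y : Euc n} (hxy : ∀ i ∈ I, ⟪x, u i⟫ = ⟪y, v i⟫) :
    g (hullZero u I) x = g (hullZero v I) y := by
  have key : ∀ x y : Euc n, (∀ i ∈ I, ⟪x, u i⟫ = ⟪y, v i⟫) → (∃ i ∈ I, ⟪x, u i⟫ ≠ 0) →
      g (hullZero u I) x = g (hullZero v I) y := by
    rintro x y hxy ⟨i, hi, hxi⟩
    obtain ⟨u', hu', huu, hu0⟩ := exists_orthogonal_outside hu hi hxi
    obtain ⟨v', hv', hvv, hv0⟩ := exists_orthogonal_outside hv hi (hxy i hi ▸ hxi)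
    obtain ⟨j, hj⟩ : ∃ j, j ∉ I := by
      by_contra! h
      exact hI (Finset.eq_univ_iff_forall.mpr h)
    have hvol : vol n u' = vol n (Function.update v' j ((vol n u' / vol n v') • v' j)) := by
      rw [vol_update_smul]; field_simp
    rw [← hullZero_congr huu, ← hullZero_congr hvv, hg.eq_of_vol_eq hu' hvol (y := y) ?_ I]
    · congr 1
      refine hullZero_congr fun k hk => ?_
      have : k ≠ j := by rintro rfl; exact hj hk
      simp [this]
    · intro k
      by_cases hk : k ∈ I
      · have : k ≠ j := by rintro rfl; exact hj hk
        simp [this, huu k hk, hvv k hk, hxy k hk]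
      · rw [hu0 k hk]
        by_cases hkj : k = j
        · subst hkj; simp [inner_smul_right, hv0 k hk]
        · simp [hkj, hv0 k hk]
  by_cases hne : ∃ i ∈ I, ⟪x, u i⟫ ≠ 0
  · exact key x y hxy hne
  push Not at hne
  rcases I.eq_empty_or_nonempty with rfl | ⟨i, hi⟩
  · rw [hg.hullZero_empty hn, hg.hullZero_empty hn]
  obtain ⟨z, hz⟩ := exists_inner_eq hu 1
  obtain ⟨z', hz'⟩ := exists_inner_eq hv 1
  have hcu := hg.cont _ (isPolytope0_hullZero u I)
  have hcv := hg.cont _ (isPolytope0_hullZero v I)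
  have := Continuous.ext_on (dense_compl_singleton (0 : ℝ))
    (f := fun ε : ℝ => g (hullZero u I) (x + ε • z))
    (g := fun ε : ℝ => g (hullZero v I) (y + ε • z'))
    (by fun_prop) (by fun_prop) (fun ε hε => by
      refine key _ _ (fun k hk => ?_) ⟨i, hi, ?_⟩
      · simp [inner_add_left, inner_smul_left, hz, hz', hxy k hk]
      · simpa [inner_add_left, inner_smul_left, hz, hne i hi] using hε)
  simpa using congrFun this 0

/-- The value of a functional on the hull of the origin and some standard unit vectors. -/
def low (g : Set (Euc n) → Euc n → ℝ) (I : Finset (Fin n)) (a : Fin n → ℝ) : ℝ :=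
  g (hullZero (EuclideanSpace.basisFun (Fin n) ℝ) I) (WithLp.toLp 2 a)

lemma vol_std_ne_zero : vol n (EuclideanSpace.basisFun (Fin n) ℝ) ≠ 0 := by
  rw [vol_std]; norm_num

lemma inner_toLp_std (a : Fin n → ℝ) (i : Fin n) :
    ⟪(WithLp.toLp 2 a : Euc n), EuclideanSpace.basisFun (Fin n) ℝ i⟫ = a i := by
  rw [real_inner_comm, EuclideanSpace.basisFun_inner]

lemma Admissible.eq_low {g : Set (Euc n) → Euc n → ℝ} (hg : Admissible g) (hn : 2 ≤ n)
    {u : Fin n → Euc n} (hu : vol n u ≠ 0) {I : Finset (Fin n)}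
    (hI : I ≠ Finset.univ) {x : Euc n} {a : Fin n → ℝ} (hxy : ∀ i ∈ I, ⟪x, u i⟫ = a i) :
    g (hullZero u I) x = low g I a :=
  hg.eq_of_inner_eq hn hu vol_std_ne_zero hI fun i hi => by rw [hxy i hi, inner_toLp_std]

lemma Admissible.low_congr {g : Set (Euc n) → Euc n → ℝ} (hg : Admissible g) (hn : 2 ≤ n)
    {I : Finset (Fin n)} (hI : I ≠ Finset.univ) {a b : Fin n → ℝ} (hab : ∀ i ∈ I, a i = b i) :
    low g I a = low g I b :=
  hg.eq_low hn vol_std_ne_zero hI fun i hi => by rw [inner_toLp_std, hab i hi]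

lemma Admissible.low_smul {g : Set (Euc n) → Euc n → ℝ} (hg : Admissible g)
    (I : Finset (Fin n)) {t : ℝ} (ht : 0 ≤ t) (a : Fin n → ℝ) :
    low g I (t • a) = t * low g I a := by
  rw [low, WithLp.toLp_smul, hg.hom _ (isPolytope0_hullZero _ _) t ht, low]

lemma Admissible.low_perm {g : Set (Euc n) → Euc n → ℝ} (hg : Admissible g) (hn : 2 ≤ n)
    {I J : Finset (Fin n)} (hI : I ≠ Finset.univ) {a b : Fin n → ℝ} (f : Fin n → Fin n)
    (hf : Set.InjOn f I) (hJ : I.image f = J) (hab : ∀ i ∈ I, a i = b (f i)) :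
    low g I a = low g J b := by
  classical
  let e : {x // x ∈ I} ≃ {x // x ∈ J} := Equiv.ofBijective
    (fun x => ⟨f x, by rw [← hJ]; exact Finset.mem_image_of_mem f x.2⟩)
    ⟨fun x y hxy => Subtype.ext (hf x.2 y.2 (congrArg Subtype.val hxy)), fun y => by
      have hy : (y : Fin n) ∈ I.image f := by rw [hJ]; exact y.2
      obtain ⟨x, hx, hxy⟩ := Finset.mem_image.mp hy
      exact ⟨⟨x, hx⟩, Subtype.ext hxy⟩⟩
  let σ : Equiv.Perm (Fin n) := e.extendSubtype
  have hσ : ∀ i ∈ I, σ i = f i := fun i hi => e.extendSubtype_apply_of_mem i hi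
  have hIJ : I.map σ.toEmbedding = J := by
    rw [← hJ, Finset.map_eq_image]
    exact Finset.image_congr fun i hi => hσ i hi
  set E := EuclideanSpace.basisFun (Fin n) ℝ
  have hv : vol n (E ∘ σ) ≠ 0 := by
    rw [AlternatingMap.map_perm]
    have := vol_std_ne_zero (n := n)
    rcases Int.units_eq_one_or (Equiv.Perm.sign σ) with h | h <;> rw [h] <;> simpa using this
  have := hg.eq_low hn hv hI (x := WithLp.toLp 2 b) (a := a) (fun i hi => by
    rw [Function.comp_apply, inner_toLp_std, hσ i hi, hab i hi])
  rw [← this, low, ← hIJ, ← hullZero_comp]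
  rfl

lemma Admissible.low_cut {g : Set (Euc n) → Euc n → ℝ} (hg : Admissible g) (hn : 2 ≤ n)
    {I : Finset (Fin n)} (hI : I ≠ Finset.univ) {i j : Fin n} (hi : i ∈ I) (hj : j ∈ I)
    (hij : i ≠ j) (a : Fin n → ℝ) :
    low g I a + low g (I.erase j) (Function.update a i ((a i + a j) / 2)) =
      low g I (Function.update a j ((a i + a j) / 2)) +
      low g I (Function.update a i ((a i + a j) / 2)) := by
  set E : Fin n → Euc n := ⇑(EuclideanSpace.basisFun (Fin n) ℝ) with hE
  have h := hg.cut vol_std_ne_zero hi hj hij (t := 1 / 2) (by norm_num) (by norm_num)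
    (WithLp.toLp 2 a)
  set w := (1 / 2 : ℝ) • E i + (1 - 1 / 2 : ℝ) • E j with hw
  have hwa : ⟪(WithLp.toLp 2 a : Euc n), w⟫ = (a i + a j) / 2 := by
    rw [hw, inner_add_right, inner_smul_right, inner_smul_right, hE, inner_toLp_std,
      inner_toLp_std]
    ring
  have hval : ∀ k l, ⟪(WithLp.toLp 2 a : Euc n), Function.update E k w l⟫
      = Function.update a k ((a i + a j) / 2) l := by
    intro k l
    by_cases hkl : l = k
    · subst hkl; simp [hwa]
    · simp only [Function.update_of_ne hkl]; rw [hE, inner_toLp_std]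
  have hvi : vol n (Function.update E i w) ≠ 0 := by
    rw [hw, vol_update_left _ hij]; simpa using vol_std_ne_zero
  have hvj : vol n (Function.update E j w) ≠ 0 := by
    rw [hw, vol_update_right _ hij]
    have := vol_std_ne_zero (n := n)
    exact mul_ne_zero (by norm_num) this
  have hI' : I.erase j ≠ Finset.univ := fun h => by
    have := Finset.mem_univ j
    rw [← h] at this
    simp at this
  rw [hg.eq_low hn hvi hI' (fun k _ => hval i k), hg.eq_low hn hvj hI (fun k _ => hval j k),
    hg.eq_low hn hvi hI (fun k _ => hval i k)] at h
  exact h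

lemma Admissible.low_erase {g : Set (Euc n) → Euc n → ℝ} (hg : Admissible g) (hn : 2 ≤ n)
    {I : Finset (Fin n)} (hI : I ≠ Finset.univ) {i j : Fin n} (hi : i ∈ I) (hj : j ∈ I)
    (hij : i ≠ j) {a : Fin n → ℝ} (ha : a i = a j) :
    low g I a = low g (I.erase j) a := by
  have h := hg.low_cut hn hI hi hj hij a
  have e : (a i + a j) / 2 = a i := by rw [← ha]; ring
  rw [e] at h
  conv at h =>
    rhs
    rw [ha]
  rw [Function.update_eq_self, Function.update_eq_self, ← ha, Function.update_eq_self] at h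
  linarith

lemma Admissible.low_reduce {g : Set (Euc n) → Euc n → ℝ} (hg : Admissible g) (hn : 2 ≤ n)
    {J : Finset (Fin n)} {a : Fin n → ℝ} :
    ∀ {I : Finset (Fin n)}, I ≠ Finset.univ → J ⊆ I →
      (∀ i ∈ I, i ∉ J → ∃ j ∈ J, a j = a i) → low g I a = low g J a := by
  intro I
  induction I using Finset.strongInduction with
  | H I ih =>
    intro hI hJI h
    by_cases hIJ : I ⊆ J
    · rw [Finset.Subset.antisymm hIJ hJI]
    · obtain ⟨i, hi, hiJ⟩ := Finset.not_subset.mp hIJ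
      obtain ⟨j, hj, hja⟩ := h i hi hiJ
      have hji : j ≠ i := by rintro rfl; exact hiJ hj
      rw [hg.low_erase hn hI (hJI hj) hi hji hja]
      refine ih _ (Finset.erase_ssubset hi) ?_ ?_ ?_
      · exact fun h => by
          have := Finset.mem_univ i
          rw [← h] at this
          simp at this
      · intro k hk
        exact Finset.mem_erase.mpr ⟨by rintro rfl; exact hiJ hk, hJI hk⟩
      · intro k hk
        exact h k (Finset.mem_of_mem_erase hk)

/-- An additive function on the positive reals that is bounded below is linear. -/
lemma eq_mul_of_additive_of_bounded {q : ℝ → ℝ} {C : ℝ}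
    (hadd : ∀ v w, 0 < v → 0 < w → q (v + w) = q v + q w) (hC : ∀ v, 0 < v → C ≤ q v)
    {v : ℝ} (hv : 0 < v) : q v = v * q 1 := by
  have hmul : ∀ (N : ℕ) (v : ℝ), 0 < v → q ((N + 1 : ℕ) * v) = (N + 1 : ℕ) * q v := by
    intro N v hv
    induction N with
    | zero => simp
    | succ N ih =>
      have : ((N + 1 + 1 : ℕ) : ℝ) * v = ((N + 1 : ℕ) : ℝ) * v + v := by push_cast; ring
      rw [this, hadd _ _ (by positivity) hv, ih]
      push_cast
      ring
  have hnn : ∀ v, 0 < v → 0 ≤ q v := by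
    intro v hv
    by_contra! hneg
    obtain ⟨N, hN⟩ := exists_nat_gt (C / q v)
    have h1 := hC ((N + 1 : ℕ) * v) (by positivity)
    rw [hmul N v hv] at h1
    rw [div_lt_iff_of_neg hneg] at hN
    push_cast at h1
    nlinarith
  have hmono : ∀ v w, 0 < v → v ≤ w → q v ≤ q w := by
    intro v w hv hvw
    rcases hvw.eq_or_lt with rfl | h
    · rfl
    · have := hadd v (w - v) hv (by linarith)
      rw [add_sub_cancel] at this
      have := hnn (w - v) (by linarith)
      linarith
  have hnat : ∀ N : ℕ, q ((N + 1 : ℕ) : ℝ) = (N + 1 : ℕ) * q 1 := fun N => by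
    simpa using hmul N 1 one_pos
  have hq1 := hnn 1 one_pos
  have key : ∀ N : ℕ, ((N + 1 : ℕ) : ℝ) * |q v - v * q 1| ≤ q 1 := by
    intro N
    set M : ℝ := ((N + 1 : ℕ) : ℝ) with hM
    have hMpos : 0 < M := by positivity
    have hMv : 0 < M * v := by positivity
    set m := ⌊M * v⌋₊ with hm
    have h1 : (m : ℝ) ≤ M * v := Nat.floor_le hMv.le
    have h2 : M * v < m + 1 := Nat.lt_floor_add_one _
    have hup : M * q v ≤ (m + 1) * q 1 := by
      rw [← hmul N v hv]
      have := hmono _ _ hMv h2.le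
      have h3 := hnat m
      push_cast at h3
      rw [h3] at this
      exact this
    have hlow : m * q 1 ≤ M * q v := by
      rcases Nat.eq_zero_or_pos m with h0 | h0
      · rw [h0]
        have := hnn v hv
        simp
        positivity
      · obtain ⟨k, hk⟩ := Nat.exists_eq_succ_of_ne_zero h0.ne'
        have h3 := hnat k
        rw [← Nat.succ_eq_add_one, ← hk] at h3
        rw [← h3, ← hmul N v hv]
        exact hmono _ _ (by exact_mod_cast h0) h1
    rw [← abs_of_pos hMpos, ← abs_mul, abs_le]
    constructor <;> nlinarith
  by_contra hne
  have hpos : 0 < |q v - v * q 1| := abs_pos.mpr (sub_ne_zero.mpr hne)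
  obtain ⟨N, hN⟩ := exists_nat_gt (q 1 / |q v - v * q 1|)
  rw [div_lt_iff₀ hpos] at hN
  have := key N
  push_cast at this
  nlinarith

lemma erase_ne_univ (i : Fin n) : Finset.univ.erase i ≠ (Finset.univ : Finset (Fin n)) := fun h => by
  have := Finset.mem_univ i
  rw [← h] at this
  simp at this

/-- On full-dimensional simplices two of whose vertices have the same height, an admissible
functional that is bounded below is an affine function of the volume. -/
lemma Admissible.exists_linear {g : Set (Euc n) → Euc n → ℝ} (hg : Admissible g) (hn : 2 ≤ n)
    {a : Fin n → ℝ} {i j : Fin n} (hij : i ≠ j) (ha : a i = a j) {C : ℝ}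
    (hC : ∀ (u : Fin n → Euc n) (x : Euc n), vol n u ≠ 0 → (∀ k, ⟪x, u k⟫ = a k) →
      C ≤ g (hullZero u Finset.univ) x) :
    ∃ θ : ℝ, ∀ (u : Fin n → Euc n) (x : Euc n), vol n u ≠ 0 → (∀ k, ⟪x, u k⟫ = a k) →
      g (hullZero u Finset.univ) x = low g (Finset.univ.erase j) a + |vol n u| * θ := by
  set E : Fin n → Euc n := ⇑(EuclideanSpace.basisFun (Fin n) ℝ) with hE
  set U : ℝ → Fin n → Euc n := fun V => Function.update E i (V • E i) with hU
  have hvolU : ∀ V, vol n (U V) = V := fun V => by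
    rw [hU]; dsimp only; rw [vol_update_smul, vol_std, mul_one]
  have hX : ∀ V : ℝ, V ≠ 0 → ∃ x : Euc n, ∀ k, ⟪x, U V k⟫ = a k := fun V hV =>
    exists_inner_eq (by rwa [hvolU]) a
  choose! X hX using hX
  set F : ℝ → ℝ := fun V => g (hullZero (U V) Finset.univ) (X V) with hF
  have hFu : ∀ (u : Fin n → Euc n) (x : Euc n), vol n u ≠ 0 → (∀ k, ⟪x, u k⟫ = a k) →
      g (hullZero u Finset.univ) x = F (vol n u) := by
    intro u x hu hx
    exact hg.eq_of_vol_eq hu (hvolU _).symm (fun k => by rw [hx k, hX _ hu k]) _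
  set L := low g (Finset.univ.erase j) a with hL
  have hadd : ∀ v w, 0 < v → 0 < w → F (v + w) - L = (F v - L) + (F w - L) := by
    intro v w hv hw
    have hvw : 0 < v + w := by positivity
    have ht0 : 0 < v / (v + w) := by positivity
    have ht1 : v / (v + w) < 1 := by rw [div_lt_one hvw]; linarith
    have hne : vol n (U (v + w)) ≠ 0 := by rw [hvolU]; exact hvw.ne'
    have h := hg.cut hne (Finset.mem_univ i) (Finset.mem_univ j) hij ht0 ht1 (X (v + w))
    set t := v / (v + w) with ht
    set z := t • U (v + w) i + (1 - t) • U (v + w) j with hz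
    have hzx : ⟪X (v + w), z⟫ = a i := by
      rw [hz, inner_add_right, inner_smul_right, inner_smul_right, hX _ hvw.ne', hX _ hvw.ne', ha]
      ring
    have hvi : vol n (Function.update (U (v + w)) i z) = v := by
      rw [hz, vol_update_left _ hij, hvolU, ht]; field_simp
    have hvj : vol n (Function.update (U (v + w)) j z) = w := by
      rw [hz, vol_update_right _ hij, hvolU, ht]; field_simp; ring
    have hvali : ∀ k, ⟪X (v + w), Function.update (U (v + w)) i z k⟫ = a k := by
      intro k
      by_cases hk : k = i
      · subst hk; simp [hzx]
      · rw [Function.update_of_ne hk, hX _ hvw.ne']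
    have hvalj : ∀ k, ⟪X (v + w), Function.update (U (v + w)) j z k⟫ = a k := by
      intro k
      by_cases hk : k = j
      · subst hk; simp [hzx, ha]
      · rw [Function.update_of_ne hk, hX _ hvw.ne']
    rw [hFu _ _ (by rw [hvi]; exact hv.ne') hvali, hFu _ _ (by rw [hvj]; exact hw.ne') hvalj,
      hg.eq_low hn (by rw [hvi]; exact hv.ne') (erase_ne_univ j) (fun k _ => hvali k),
      hvi, hvj, hFu _ _ hne (hX _ hvw.ne'), hvolU] at h
    linarith
  have hlin := fun V (hV : 0 < V) => eq_mul_of_additive_of_bounded (q := fun V => F V - L)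
    (C := C - L) hadd (fun v hv => by
      have := hC (U v) (X v) (by rw [hvolU]; exact hv.ne') (hX v hv.ne')
      simp only [hF]
      linarith) hV
  refine ⟨F 1 - L, fun u x hu hx => ?_⟩
  rcases lt_or_gt_of_ne hu with hneg | hpos
  · set s := Equiv.swap i j
    have hvs : vol n (u ∘ s) = -vol n u := AlternatingMap.map_swap _ _ hij
    have hs : hullZero (u ∘ s) Finset.univ = hullZero u Finset.univ := by
      have := hullZero_comp u s.toEmbedding Finset.univ
      rw [Finset.map_univ_equiv] at this
      exact this
    have hxs : ∀ k, ⟪x, (u ∘ s) k⟫ = a k := by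
      intro k
      rw [Function.comp_apply, hx]
      by_cases hki : k = i
      · subst hki; simp [s, ha]
      · by_cases hkj : k = j
        · subst hkj; simp [s, ha]
        · simp [s, Equiv.swap_apply_of_ne_of_ne hki hkj]
    have h := hlin (-vol n u) (by linarith)
    rw [← hs, hFu _ _ (by rw [hvs]; exact neg_ne_zero.mpr hu) hxs, hvs, abs_of_neg hneg]
    linarith
  · have h := hlin (vol n u) hpos
    rw [hFu u x hu hx, abs_of_pos hpos]
    linarith

lemma Admissible.low_pair {g : Set (Euc n) → Euc n → ℝ} (hg : Admissible g) (hn : 2 ≤ n)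
    {i j i' j' : Fin n} (hij : i ≠ j) (hij' : i' ≠ j') (hI : ({i, j} : Finset (Fin n)) ≠ Finset.univ)
    {a b : Fin n → ℝ} (hi : a i = b i') (hj : a j = b j') :
    low g {i, j} a = low g {i', j'} b := by
  refine hg.low_perm hn hI (fun k => if k = i then i' else j') ?_ ?_ ?_
  · intro x hx y hy hxy
    simp only [Finset.coe_insert, Finset.coe_singleton, Set.mem_insert_iff,
      Set.mem_singleton_iff] at hx hy
    rcases hx with rfl | rfl <;> rcases hy with rfl | rfl <;>
      simp_all [hij.symm, hij'.symm]
  · simp [Finset.image_insert, hij.symm]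
  · intro k hk
    simp only [Finset.mem_insert, Finset.mem_singleton] at hk
    rcases hk with rfl | rfl
    · simp [hi]
    · simp [hj, hij.symm]

lemma Admissible.low_triple {g : Set (Euc n) → Euc n → ℝ} (hg : Admissible g) (hn : 2 ≤ n)
    {i j k i' j' k' : Fin n} (hij : i ≠ j) (hik : i ≠ k) (hjk : j ≠ k) (hij' : i' ≠ j')
    (hik' : i' ≠ k') (hjk' : j' ≠ k') (hI : ({i, j, k} : Finset (Fin n)) ≠ Finset.univ)
    {a b : Fin n → ℝ} (hi : a i = b i') (hj : a j = b j') (hk : a k = b k') :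
    low g {i, j, k} a = low g {i', j', k'} b := by
  refine hg.low_perm hn hI (fun l => if l = i then i' else if l = j then j' else k') ?_ ?_ ?_
  · intro x hx y hy hxy
    simp only [Finset.coe_insert, Finset.coe_singleton, Set.mem_insert_iff,
      Set.mem_singleton_iff] at hx hy
    rcases hx with rfl | rfl | rfl <;> rcases hy with rfl | rfl | rfl <;>
      simp_all [hij.symm, hij'.symm, hik.symm, hik'.symm, hjk.symm, hjk'.symm]
  · simp [Finset.image_insert, hij.symm, hik.symm, hjk.symm]
  · intro l hl
    simp only [Finset.mem_insert, Finset.mem_singleton] at hl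
    rcases hl with rfl | rfl | rfl
    · simp [hi]
    · simp [hj, hij.symm]
    · simp [hk, hik.symm, hjk.symm]

lemma hullZero_union_neg [DecidableEq (Fin n)] (u : Fin n → Euc n) (i : Fin n) :
    IsPolytope0 (hullZero u Finset.univ ∪
      hullZero (Function.update u i (-u i)) Finset.univ) := by
  classical
  set U : Option (Fin n) → Euc n := fun o => o.elim (-u i) u with hU
  have h := hullZero_update_union (u := U) (Finset.mem_univ (some i)) (Finset.mem_univ none)
    (by simp) (t := 1 / 2) (by norm_num) (by norm_num)
  have hw : (1 / 2 : ℝ) • U (some i) + (1 - 1 / 2 : ℝ) • U none = 0 := by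
    simp only [hU, Option.elim]
    rw [smul_neg, ← sub_eq_add_neg, ← sub_smul]
    norm_num
  rw [hw] at h
  have h1 : hullZero (Function.update U none 0) Finset.univ = hullZero u Finset.univ := by
    rw [hullZero, hullZero]
    congr 1
    ext z
    simp only [Set.mem_insert_iff, Set.mem_image, Finset.coe_univ, Set.mem_univ, true_and]
    constructor
    · rintro (h | ⟨_ | k, h⟩)
      · exact Or.inl h
      · left; simpa using h.symm
      · right; exact ⟨k, by simpa [hU] using h⟩
    · rintro (h | ⟨k, h⟩)
      · exact Or.inl h
      · right; exact ⟨some k, by simpa [hU] using h⟩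
  have h2 : hullZero (Function.update U (some i) 0) Finset.univ
      = hullZero (Function.update u i (-u i)) Finset.univ := by
    rw [hullZero, hullZero]
    congr 1
    ext z
    simp only [Set.mem_insert_iff, Set.mem_image, Finset.coe_univ, Set.mem_univ, true_and]
    constructor
    · rintro (h | ⟨_ | k, h⟩)
      · exact Or.inl h
      · right; exact ⟨i, by simpa [hU] using h⟩
      · by_cases hk : k = i
        · subst hk; left; simpa using h.symm
        · right; exact ⟨k, by simpa [hk, hU] using h⟩
    · rintro (h | ⟨k, h⟩)
      · exact Or.inl h
      · by_cases hk : k = i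
        · subst hk; right; exact ⟨none, by simpa [hU] using h⟩
        · right; exact ⟨some k, by simpa [hk, hU] using h⟩
  rw [h1, h2] at h
  rw [h]
  exact isPolytope0_hullZero _ _

lemma hullZero_inter_neg {u : Fin n → Euc n} (hu : vol n u ≠ 0) (i : Fin n) :
    hullZero u Finset.univ ∩ hullZero (Function.update u i (-u i)) Finset.univ =
      hullZero u (Finset.univ.erase i) := by
  ext z
  rw [Set.mem_inter_iff, mem_hullZero, mem_hullZero, mem_hullZero]
  constructor
  · rintro ⟨⟨c, hc0, -, hc1, hc⟩, ⟨d, hd0, -, hd1, hd⟩⟩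
    rw [← hc] at hd
    rw [sum_smul_update] at hd
    have hd' : ∑ k, (d k - if k = i then 2 * d i else 0) • u k = ∑ k, c k • u k := by
      rw [← hd]
      simp only [sub_smul, Finset.sum_sub_distrib, ite_smul, zero_smul, Finset.sum_ite_eq',
        Finset.mem_univ, if_true, smul_sub, smul_neg, two_mul, add_smul]
      abel
    have h := congrFun (coeff_unique hu hd') i
    simp at h
    have hci : c i = 0 := by linarith [hc0 i, hd0 i]
    refine ⟨c, hc0, fun k hk => ?_, hc1, hc⟩
    have : k = i := by simpa using hk
    rw [this, hci]
  · rintro ⟨c, hc0, hcI, hc1, hc⟩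
    have hci : c i = 0 := hcI i (by simp)
    refine ⟨⟨c, hc0, by simp, hc1, hc⟩, ⟨c, hc0, by simp, hc1, ?_⟩⟩
    rw [sum_smul_update, hci, zero_smul, add_zero, hc]

/-- Doubling a simplex across a face. -/
lemma Admissible.union_neg {g : Set (Euc n) → Euc n → ℝ} (hg : Admissible g)
    {u : Fin n → Euc n} (hu : vol n u ≠ 0) (i : Fin n) (x : Euc n) :
    g (hullZero u Finset.univ ∪ hullZero (Function.update u i (-u i)) Finset.univ) x +
      g (hullZero u (Finset.univ.erase i)) x =
    g (hullZero u Finset.univ) x + g (hullZero (Function.update u i (-u i)) Finset.univ) x := by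
  rw [← hullZero_inter_neg hu i]
  exact hg.val _ _ (isPolytope0_hullZero _ _) (isPolytope0_hullZero _ _) (hullZero_union_neg u i)
    (by rw [hullZero_inter_neg hu i]; exact isPolytope0_hullZero _ _) x

/-- For a sublinear nonnegative functional the value on a triangle is forced by the value on a
segment. -/
lemma Admissible.low_pair_eq_low_singleton {g : Set (Euc n) → Euc n → ℝ} (hg : Admissible g)
    (hn : 2 ≤ n)
    (hsub : ∀ P, IsPolytope0 P → ∀ x y, g P (x + y) ≤ g P x + g P y)
    (hnn : ∀ P, IsPolytope0 P → ∀ x, 0 ≤ g P x) {i₀ i₁ i₂ i₃ : Fin n} (h01 : i₀ ≠ i₁)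
    (h02 : i₀ ≠ i₂) (h03 : i₀ ≠ i₃) (h12 : i₁ ≠ i₂) (h13 : i₁ ≠ i₃) (h23 : i₂ ≠ i₃) :
    low g {i₀, i₁} (Pi.single i₀ 1) = low g {i₀} (Pi.single i₀ 1) := by
  have hU3 : ({i₀, i₁, i₂} : Finset (Fin n)) ≠ Finset.univ := fun h => by
    have := Finset.mem_univ i₃
    rw [← h] at this
    simp [h03.symm, h13.symm, h23.symm] at this
  have hU2 : ∀ i j, i ≠ j → ({i, j} : Finset (Fin n)) ≠ Finset.univ := fun i j hij h => by
    have h1 : (Finset.univ : Finset (Fin n)).card = 2 := by rw [← h, Finset.card_pair hij]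
    have h2 := Finset.card_le_univ ({i₀, i₁, i₂} : Finset (Fin n))
    rw [Finset.card_eq_three.mpr ⟨i₀, i₁, i₂, h01, h02, h12, rfl⟩] at h2
    rw [Finset.card_univ] at h1
    omega
  set v : ℝ → ℝ → ℝ → ℝ → Fin n → ℝ := fun α β γ δ k =>
    if k = i₀ then α else if k = i₁ then β else if k = i₂ then γ else δ with hv
  have v0 : ∀ α β γ δ, v α β γ δ i₀ = α := by intros; simp [hv]
  have v1 : ∀ α β γ δ, v α β γ δ i₁ = β := by intros; simp [hv, h01.symm]
  have v2 : ∀ α β γ δ, v α β γ δ i₂ = γ := by intros; simp [hv, h02.symm, h12.symm]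
  have vr : ∀ α β γ δ k, k ≠ i₀ → k ≠ i₁ → k ≠ i₂ → v α β γ δ k = δ := by
    intro α β γ δ k h h' h''; simp [hv, h, h', h'']
  have v3 : ∀ α β γ δ, v α β γ δ i₃ = δ := fun α β γ δ => vr _ _ _ _ _ h03.symm h13.symm h23.symm
  have vadd : ∀ α β γ δ α' β' γ' δ', v α β γ δ + v α' β' γ' δ' = v (α + α') (β + β') (γ + γ') (δ + δ') := by
    intros; funext k; simp only [hv, Pi.add_apply]; split_ifs <;> rfl
  have vsmul : ∀ t α β γ δ, t • v α β γ δ = v (t * α) (t * β) (t * γ) (t * δ) := by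
    intros; funext k; simp only [hv, Pi.smul_apply, smul_eq_mul]; split_ifs <;> rfl
  set T2 : ℝ → ℝ → ℝ := fun α β => low g {i₀, i₁} (v α β 0 0) with hT2
  set T3 : ℝ → ℝ → ℝ → ℝ := fun α β γ => low g {i₀, i₁, i₂} (v α β γ 0) with hT3
  have toT2 : ∀ i j a, i ≠ j → low g {i, j} a = T2 (a i) (a j) := fun i j a hij =>
    hg.low_pair hn hij h01 (hU2 i j hij) (v0 _ _ _ _).symm (v1 _ _ _ _).symm
  have toT3 : ∀ i j k a, i ≠ j → i ≠ k → j ≠ k → low g {i, j, k} a = T3 (a i) (a j) (a k) :=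
    fun i j k a hij hik hjk => (hg.low_triple hn h01 h02 h12 hij hik hjk hU3
      (v0 _ _ _ _) (v1 _ _ _ _) (v2 _ _ _ _)).symm
  have T2s : ∀ α β, T2 α β = T2 β α := by
    intro α β
    have := toT2 i₁ i₀ (v α β 0 0) h01.symm
    rw [v0, v1, Finset.pair_comm] at this
    exact this
  have T2h : ∀ t α β, 0 ≤ t → T2 (t * α) (t * β) = t * T2 α β := by
    intro t α β ht
    have := hg.low_smul {i₀, i₁} ht (v α β 0 0)
    rw [vsmul, mul_zero] at this
    exact this
  have T3h : ∀ t α β γ, 0 ≤ t → T3 (t * α) (t * β) (t * γ) = t * T3 α β γ := by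
    intro t α β γ ht
    have := hg.low_smul {i₀, i₁, i₂} ht (v α β γ 0)
    rw [vsmul, mul_zero] at this
    exact this
  have T311 : ∀ α β, T3 α β β = T2 α β := by
    intro α β
    have h := hg.low_erase hn hU3 (i := i₁) (j := i₂) (by simp) (by simp) h12 (a := v α β β 0)
      (by rw [v1, v2])
    have e : ({i₀, i₁, i₂} : Finset (Fin n)).erase i₂ = {i₀, i₁} := by
      ext k; simp only [Finset.mem_erase, Finset.mem_insert, Finset.mem_singleton]
      constructor
      · tauto
      · rintro (rfl | rfl) <;> simp [*]
    rw [e, toT2 _ _ _ h01, v0, v1] at h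
    exact h
  have T3s : ∀ α β γ, T3 α β γ = T3 γ β α := by
    intro α β γ
    have := toT3 i₂ i₁ i₀ (v α β γ 0) h12.symm h02.symm h01.symm
    rw [v0, v1, v2] at this
    rw [← this]
    simp only [hT3]
    congr 1
    ext k; simp only [Finset.mem_insert, Finset.mem_singleton]; tauto
  have T3s' : ∀ α β γ, T3 α β γ = T3 β α γ := by
    intro α β γ
    have := toT3 i₁ i₀ i₂ (v α β γ 0) h01.symm h12 h02
    rw [v0, v1, v2] at this
    rw [← this]
    simp only [hT3]
    congr 1
    ext k; simp only [Finset.mem_insert, Finset.mem_singleton]; tauto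
  set b := T2 1 1 with hb
  set p := T2 1 0 with hp
  have hbgoal : low g {i₀} (Pi.single i₀ 1) = b := by
    have h := hg.low_erase hn (hU2 i₀ i₁ h01) (i := i₀) (j := i₁) (by simp) (by simp) h01
      (a := v 1 1 0 0) (by rw [v0, v1])
    have e : ({i₀, i₁} : Finset (Fin n)).erase i₁ = {i₀} := by
      ext k; simp only [Finset.mem_erase, Finset.mem_insert, Finset.mem_singleton]
      constructor
      · tauto
      · rintro rfl; simp [*]
    rw [e] at h
    rw [hb]
    simp only [hT2]
    rw [h]
    refine hg.low_congr hn (fun h => ?_) fun i hi => ?_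
    · have := Finset.mem_univ i₁
      rw [← h] at this
      simp [h01.symm] at this
    · rw [Finset.mem_singleton] at hi
      subst hi
      simp [v0]
  have hpgoal : low g {i₀, i₁} (Pi.single i₀ 1) = p := by
    rw [toT2 _ _ _ h01]; simp [h01.symm, hp]
  have hT2cut : T2 2 1 = p + b := by
    have h := hg.low_cut hn (hU2 i₀ i₁ h01) (i := i₀) (j := i₁) (by simp) (by simp) h01 (v 2 0 0 0)
    have e : ({i₀, i₁} : Finset (Fin n)).erase i₁ = {i₀} := by
      ext k; simp only [Finset.mem_erase, Finset.mem_insert, Finset.mem_singleton]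
      constructor
      · tauto
      · rintro rfl; simp [*]
    have e1 : low g {i₀} (Function.update (v 2 0 0 0) i₀ ((2 + 0) / 2)) = b := by
      rw [← hbgoal]
      refine hg.low_congr hn (fun h => ?_) fun i hi => ?_
      · have := Finset.mem_univ i₁
        rw [← h] at this
        simp [h01.symm] at this
      · rw [Finset.mem_singleton] at hi
        subst hi
        simp
    rw [v0, v1, e, e1, toT2 _ _ _ h01, toT2 _ _ _ h01, toT2 _ _ _ h01] at h
    simp only [Function.update_self, Function.update_of_ne h01, Function.update_of_ne h01.symm,
      v0, v1] at h
    norm_num at h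
    have h2 := T2h 2 1 0 (by norm_num)
    norm_num at h2
    rw [← hp] at h h2
    linarith
  have hT3cut : T3 0 2 1 = 2 * p := by
    have h := hg.low_cut hn hU3 (i := i₀) (j := i₁) (by simp) (by simp) h01 (v 0 2 1 0)
    have e : ({i₀, i₁, i₂} : Finset (Fin n)).erase i₁ = {i₀, i₂} := by
      ext k; simp only [Finset.mem_erase, Finset.mem_insert, Finset.mem_singleton]
      constructor
      · tauto
      · rintro (rfl | rfl) <;> simp [*, h12.symm]
    rw [v0, v1, e, toT2 _ _ _ h02, toT3 _ _ _ _ h01 h02 h12, toT3 _ _ _ _ h01 h02 h12,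
      toT3 _ _ _ _ h01 h02 h12] at h
    simp only [Function.update_self, Function.update_of_ne h01, Function.update_of_ne h01.symm,
      Function.update_of_ne h02.symm, Function.update_of_ne h12.symm, v0, v1, v2] at h
    norm_num at h
    rw [T3s' 1 2 1, T311, T311, hT2cut, T2s 0 1] at h
    linarith
  have hbp : b ≤ p := by
    have h := hsub _ (isPolytope0_hullZero (EuclideanSpace.basisFun (Fin n) ℝ) {i₀, i₁, i₂})
      (WithLp.toLp 2 (v 2 2 0 0)) (WithLp.toLp 2 (v 2 0 2 0))
    rw [← WithLp.toLp_add, vadd, add_zero (0 : ℝ)] at h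
    change T3 (2 + 2) (2 + 0) (0 + 2) ≤ T3 2 2 0 + T3 2 0 2 at h
    have h1 := T3h 2 2 1 1 (by norm_num)
    have h2 := T2h 2 1 0 (by norm_num)
    rw [T3s 2 2 0, T311, T3s' 2 0 2, T311, T2s 0 2] at h
    rw [T311, T311, hT2cut] at h1
    norm_num at h h1 h2
    rw [T311, h1, h2] at h
    linarith
  have hlow : ∀ (j : Fin n) (J : Finset (Fin n)) (a : Fin n → ℝ), j ∉ J →
      (∀ i, i ≠ j → i ∉ J → ∃ k ∈ J, a k = a i) → low g (Finset.univ.erase j) a = low g J a := by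
    intro j J a hj h
    refine hg.low_reduce hn (erase_ne_univ j) (fun k hk => ?_) fun i hi => h i (by simpa using hi)
    simp only [Finset.mem_erase, Finset.mem_univ, and_true]
    rintro rfl
    exact hj hk
  have h20 : T2 2 0 = 2 * p := by simpa using T2h 2 1 0 (by norm_num)
  have h02' : T2 0 2 = 2 * p := by rw [T2s, h20]
  obtain ⟨θ₁, hθ₁⟩ := hg.exists_linear hn (a := v 0 2 0 2) h02 (by rw [v0, v2]) (C := 0)
    (fun u x _ _ => hnn _ (isPolytope0_hullZero _ _) _)
  obtain ⟨θ₂, hθ₂⟩ := hg.exists_linear hn (a := v 0 0 2 2) h01 (by rw [v0, v1]) (C := 0)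
    (fun u x _ _ => hnn _ (isPolytope0_hullZero _ _) _)
  obtain ⟨θ₃, hθ₃⟩ := hg.exists_linear hn (a := v 0 2 2 4) h12 (by rw [v1, v2]) (C := 0)
    (fun u x _ _ => hnn _ (isPolytope0_hullZero _ _) _)
  have L1 : low g (Finset.univ.erase i₂) (v 0 2 0 2) = 2 * p := by
    rw [hlow i₂ {i₀, i₁} _ (by simp [h02.symm, h12.symm]) (fun i hi hiJ => ⟨i₁, by simp, by
      simp only [Finset.mem_insert, Finset.mem_singleton, not_or] at hiJ
      rw [v1, vr _ _ _ _ i hiJ.1 hiJ.2 hi]⟩), toT2 _ _ _ h01, v0, v1, h02']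
  have L2 : low g (Finset.univ.erase i₁) (v 0 0 2 2) = 2 * p := by
    rw [hlow i₁ {i₀, i₂} _ (by simp [h01.symm, h12]) (fun i hi hiJ => ⟨i₂, by simp, by
      simp only [Finset.mem_insert, Finset.mem_singleton, not_or] at hiJ
      rw [v2, vr _ _ _ _ i hiJ.1 hi hiJ.2]⟩), toT2 _ _ _ h02, v0, v2, h02']
  have L3 : low g (Finset.univ.erase i₂) (v 0 2 2 4) = 4 * p := by
    rw [hlow i₂ {i₀, i₁, i₃} _ (by simp [h02.symm, h12.symm, h23]) (fun i hi hiJ => ⟨i₃, by simp, by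
      simp only [Finset.mem_insert, Finset.mem_singleton, not_or] at hiJ
      rw [v3, vr _ _ _ _ i hiJ.1 hiJ.2.1 hi]⟩), toT3 _ _ _ _ h01 h03 h13, v0, v1, v3]
    have h := T3h 2 0 2 1 (by norm_num)
    rw [hT3cut, T3s' (2 * 0), T3s (2 * 2), T3s' (2 * 1)] at h
    norm_num at h
    rw [h]
    ring
  have M1 : low g (Finset.univ.erase i₀) (v 0 2 0 2) = 2 * p := by
    rw [hlow i₀ {i₁, i₂} _ (by simp [h01, h02]) (fun i hi hiJ => ⟨i₁, by simp, by
      simp only [Finset.mem_insert, Finset.mem_singleton, not_or] at hiJ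
      rw [v1, vr _ _ _ _ i hi hiJ.1 hiJ.2]⟩), toT2 _ _ _ h12, v1, v2, h20]
  have M2 : low g (Finset.univ.erase i₀) (v 0 0 2 2) = 2 * p := by
    rw [hlow i₀ {i₁, i₂} _ (by simp [h01, h02]) (fun i hi hiJ => ⟨i₂, by simp, by
      simp only [Finset.mem_insert, Finset.mem_singleton, not_or] at hiJ
      rw [v2, vr _ _ _ _ i hi hiJ.1 hiJ.2]⟩), toT2 _ _ _ h12, v1, v2, h02']
  have M3 : low g (Finset.univ.erase i₀) (v 0 2 2 4) = 2 * (p + b) := by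
    rw [hlow i₀ {i₁, i₃} _ (by simp [h01, h03]) (fun i hi hiJ => by
      simp only [Finset.mem_insert, Finset.mem_singleton, not_or] at hiJ
      by_cases h : i = i₂
      · exact ⟨i₁, by simp, by rw [h, v1, v2]⟩
      · exact ⟨i₃, by simp, by rw [v3, vr _ _ _ _ i hi hiJ.1 h]⟩), toT2 _ _ _ h13, v1, v3]
    have h := T2h 2 2 1 (by norm_num)
    rw [T2s, hT2cut] at h
    norm_num at h
    rw [h]
  have hmain : ∀ V : ℝ, 0 < V → 6 * p - 2 * b + 2 * V * θ₃ ≤ 4 * p + 2 * V * (θ₁ + θ₂) := by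
    intro V hV
    set E : Fin n → Euc n := ⇑(EuclideanSpace.basisFun (Fin n) ℝ) with hE
    set u : Fin n → Euc n := Function.update E i₀ (V • E i₀) with hu
    have hvol : vol n u = V := by rw [hu, vol_update_smul, vol_std, mul_one]
    have hu0 : vol n u ≠ 0 := by rw [hvol]; exact hV.ne'
    have hvol' : vol n (Function.update u i₀ (-u i₀)) = -V := by
      rw [← neg_one_smul ℝ (u i₀), vol_update_smul, hvol]; ring
    have hu0' : vol n (Function.update u i₀ (-u i₀)) ≠ 0 := by
      rw [hvol']; exact neg_ne_zero.mpr hV.ne'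
    obtain ⟨x₁, hx₁⟩ := exists_inner_eq hu0 (v 0 2 0 2)
    obtain ⟨x₂, hx₂⟩ := exists_inner_eq hu0 (v 0 0 2 2)
    have hx₃ : ∀ k, ⟪x₁ + x₂, u k⟫ = v 0 2 2 4 k := by
      intro k
      rw [inner_add_left, hx₁, hx₂, ← Pi.add_apply, vadd]
      norm_num
    have hneg : ∀ (x : Euc n) (a : Fin n → ℝ), a i₀ = 0 → (∀ k, ⟪x, u k⟫ = a k) →
        ∀ k, ⟪x, Function.update u i₀ (-u i₀) k⟫ = a k := by
      intro x a ha hx k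
      by_cases hk : k = i₀
      · subst hk; simp [hx, ha, inner_neg_right]
      · rw [Function.update_of_ne hk, hx]
    have hQ := hsub _ (hullZero_union_neg u i₀) x₁ x₂
    have e1 := hg.union_neg hu0 i₀ x₁
    have e2 := hg.union_neg hu0 i₀ x₂
    have e3 := hg.union_neg hu0 i₀ (x₁ + x₂)
    rw [hθ₁ _ _ hu0 hx₁, hθ₁ _ _ hu0' (hneg _ _ (v0 _ _ _ _) hx₁),
      hg.eq_low hn hu0 (erase_ne_univ i₀) (fun k _ => hx₁ k), hvol, hvol', abs_neg,
      abs_of_pos hV, L1, M1] at e1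
    rw [hθ₂ _ _ hu0 hx₂, hθ₂ _ _ hu0' (hneg _ _ (v0 _ _ _ _) hx₂),
      hg.eq_low hn hu0 (erase_ne_univ i₀) (fun k _ => hx₂ k), hvol, hvol', abs_neg,
      abs_of_pos hV, L2, M2] at e2
    rw [hθ₃ _ _ hu0 hx₃, hθ₃ _ _ hu0' (hneg _ _ (v0 _ _ _ _) hx₃),
      hg.eq_low hn hu0 (erase_ne_univ i₀) (fun k _ => hx₃ k), hvol, hvol', abs_neg,
      abs_of_pos hV, L3, M3] at e3
    linarith
  have hpb : p ≤ b := by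
    by_contra! hlt
    set c := θ₁ + θ₂ - θ₃ with hc
    have h := hmain ((p - b) / (2 * (|c| + 1))) (by have := abs_nonneg c; apply div_pos <;> linarith)
    set W := (p - b) / (2 * (|c| + 1)) with hW
    have hc1 : 0 < |c| + 1 := by positivity
    have hW1 : W * (2 * (|c| + 1)) = p - b := by rw [hW]; field_simp
    have hW0 : 0 < W := by rw [hW]; apply div_pos <;> linarith
    have h1 : W * c ≤ W * |c| := mul_le_mul_of_nonneg_left (le_abs_self c) hW0.le
    have h2 : 2 * (p - b) ≤ 2 * (W * c) := by rw [hc]; linarith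
    linarith
  rw [hpgoal, hbgoal]
  exact le_antisymm hpb hbp

lemma card_filter_inner_lt {u u' : Fin n → Euc n} {I I' : Finset (Fin n)} {x : Euc n}
    (hI : I' ⊆ I) (h : ∀ k ∈ I', ⟪x, u' k⟫ ≠ 0 → ⟪x, u k⟫ ≠ 0) {k : Fin n} (hk : k ∈ I)
    (hku : ⟪x, u k⟫ ≠ 0) (hk' : k ∈ I' → ⟪x, u' k⟫ = 0) :
    (I'.filter fun i => ⟪x, u' i⟫ ≠ 0).card < (I.filter fun i => ⟪x, u i⟫ ≠ 0).card := by
  refine Finset.card_lt_card (Finset.ssubset_iff_subset_ne.mpr ⟨fun i hi => ?_, fun he => ?_⟩)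
  · rw [Finset.mem_filter] at hi ⊢
    exact ⟨hI hi.1, h i hi.1 hi.2⟩
  · have : k ∈ I.filter fun i => ⟪x, u i⟫ ≠ 0 := Finset.mem_filter.mpr ⟨hk, hku⟩
    rw [← he, Finset.mem_filter] at this
    exact this.2 (hk' this.1)

/-- An admissible functional vanishes on all simplices as soon as it vanishes when at most one
vertex has nonzero height. -/
lemma Admissible.hullZero_eq_zero {g : Set (Euc n) → Euc n → ℝ} (hg : Admissible g)
    (H : ∀ (u : Fin n → Euc n) (I : Finset (Fin n)) (x : Euc n), vol n u ≠ 0 →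
      (∀ i ∈ I, ∀ j ∈ I, ⟪x, u i⟫ ≠ 0 → ⟪x, u j⟫ ≠ 0 → i = j) → g (hullZero u I) x = 0)
    {u : Fin n → Euc n} (hu : vol n u ≠ 0) (I : Finset (Fin n)) (x : Euc n) :
    g (hullZero u I) x = 0 := by
  suffices h : ∀ (m : ℕ) (u : Fin n → Euc n) (I : Finset (Fin n)) (x : Euc n), vol n u ≠ 0 →
      (I.filter fun i => ⟪x, u i⟫ ≠ 0).card < m → g (hullZero u I) x = 0 from
    h _ u I x hu (Nat.lt_succ_self _)
  clear hu u I x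
  intro m
  induction m with
  | zero => intro u I x _ h; exact absurd h (Nat.not_lt_zero _)
  | succ m ih =>
    have opp : ∀ (u : Fin n → Euc n) (I : Finset (Fin n)) (x : Euc n), vol n u ≠ 0 →
        (I.filter fun i => ⟪x, u i⟫ ≠ 0).card < m + 1 → ∀ i ∈ I, ∀ j ∈ I, i ≠ j →
        ⟪x, u i⟫ < 0 → 0 < ⟪x, u j⟫ → g (hullZero u I) x = 0 := by
      intro u I x hu hm i hi j hj hij ha hb
      set a := ⟪x, u i⟫ with hadef
      set b := ⟪x, u j⟫ with hbdef
      have hab : 0 < b - a := by linarith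
      have ht0 : 0 < b / (b - a) := by positivity
      have ht1 : b / (b - a) < 1 := by rw [div_lt_one hab]; linarith
      have hc := hg.cut hu hi hj hij ht0 ht1 x
      set t := b / (b - a) with ht
      set w := t • u i + (1 - t) • u j with hw
      have hxw : ⟪x, w⟫ = 0 := by
        rw [hw, inner_add_right, inner_smul_right, inner_smul_right, ← hadef, ← hbdef, ht]
        field_simp
        ring
      have hvi : vol n (Function.update u i w) ≠ 0 := by
        rw [hw, vol_update_left _ hij]; exact mul_ne_zero ht0.ne' hu
      have hvj : vol n (Function.update u j w) ≠ 0 := by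
        rw [hw, vol_update_right _ hij]; exact mul_ne_zero (by linarith) hu
      have hval : ∀ l k, ⟪x, Function.update u l w k⟫ ≠ 0 → ⟪x, u k⟫ ≠ 0 := by
        intro l k hk
        by_cases hkl : k = l
        · subst hkl; rw [Function.update_self] at hk; exact absurd hxw hk
        · rwa [Function.update_of_ne hkl] at hk
      have e1 : g (hullZero (Function.update u i w) (I.erase j)) x = 0 :=
        ih _ _ _ hvi (lt_of_lt_of_le (card_filter_inner_lt (Finset.erase_subset _ _)
          (fun k _ => hval i k) hi ha.ne (fun _ => by simp [hxw])) (Nat.lt_succ_iff.mp hm))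
      have e2 : g (hullZero (Function.update u i w) I) x = 0 :=
        ih _ _ _ hvi (lt_of_lt_of_le (card_filter_inner_lt subset_rfl
          (fun k _ => hval i k) hi ha.ne (fun _ => by simp [hxw])) (Nat.lt_succ_iff.mp hm))
      have e3 : g (hullZero (Function.update u j w) I) x = 0 :=
        ih _ _ _ hvj (lt_of_lt_of_le (card_filter_inner_lt subset_rfl
          (fun k _ => hval j k) hj hb.ne' (fun _ => by simp [hxw])) (Nat.lt_succ_iff.mp hm))
      linarith
    have same : ∀ (u : Fin n → Euc n) (I : Finset (Fin n)) (x : Euc n), vol n u ≠ 0 →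
        (I.filter fun i => ⟪x, u i⟫ ≠ 0).card < m + 1 → ∀ i ∈ I, ∀ j ∈ I, i ≠ j →
        ⟪x, u i⟫ ≠ 0 → 0 < ⟪x, u i⟫ / ⟪x, u j⟫ → ⟪x, u i⟫ / ⟪x, u j⟫ < 1 →
        g (hullZero u I) x = 0 := by
      intro u I x hu hm i hi j hj hij ha hq0 hq1
      have hb : ⟪x, u j⟫ ≠ 0 := by
        intro h; rw [h, div_zero] at hq0; exact lt_irrefl _ hq0
      set q := ⟪x, u i⟫ / ⟪x, u j⟫ with hq
      have hqa : ⟪x, u i⟫ = q * ⟪x, u j⟫ := by rw [hq]; field_simp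
      set t := 1 - q with ht
      have ht0 : 0 < t := by linarith
      have ht1 : t < 1 := by linarith
      set u' := Function.update u i (t⁻¹ • u i + (-(t⁻¹ * q)) • u j) with hu'
      have hvol' : vol n u' ≠ 0 := by
        rw [hu', vol_update_left _ hij]; exact mul_ne_zero (inv_ne_zero ht0.ne') hu
      have hu'i : u' i = t⁻¹ • u i + (-(t⁻¹ * q)) • u j := by rw [hu', Function.update_self]
      have hu'k : ∀ k, k ≠ i → u' k = u k := fun k hk => by rw [hu', Function.update_of_ne hk]
      have hxi : ⟪x, u' i⟫ = 0 := by
        rw [hu'i, inner_add_right, inner_smul_right, inner_smul_right, hqa]; ring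
      have hc := hg.cut hvol' hi hj hij ht0 ht1 x
      have hw : t • u' i + (1 - t) • u' j = u i := by
        have : 1 - t = q := by rw [ht]; ring
        rw [hu'i, hu'k j hij.symm, this, smul_add, smul_smul, smul_smul, mul_inv_cancel₀ ht0.ne',
          one_smul, add_assoc, ← add_smul, mul_neg, ← mul_assoc, mul_inv_cancel₀ ht0.ne']
        simp
      have hvj : vol n (Function.update u' j (u i)) ≠ 0 := by
        rw [← hw, vol_update_right _ hij]; exact mul_ne_zero (by linarith) hvol'
      have hui : Function.update u' i (u i) = u := by
        rw [hu', Function.update_idem, Function.update_eq_self]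
      rw [hw, hui] at hc
      have e1 : g (hullZero u (I.erase j)) x = 0 :=
        ih _ _ _ hu (lt_of_lt_of_le (card_filter_inner_lt (Finset.erase_subset _ _)
          (fun k _ => id) hj hb (fun h => absurd h (Finset.notMem_erase _ _)))
          (Nat.lt_succ_iff.mp hm))
      have e2 : g (hullZero u' I) x = 0 :=
        ih _ _ _ hvol' (lt_of_lt_of_le (card_filter_inner_lt subset_rfl
          (fun k _ hk => by
            by_cases hki : k = i
            · subst hki; exact absurd hxi hk
            · rwa [hu'k k hki] at hk) hi ha (fun _ => hxi)) (Nat.lt_succ_iff.mp hm))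
      have e3 : g (hullZero (Function.update u' j (u i)) I) x = 0 :=
        ih _ _ _ hvj (lt_of_lt_of_le (card_filter_inner_lt subset_rfl
          (fun k _ hk => by
            by_cases hkj : k = j
            · subst hkj; exact hb
            · rw [Function.update_of_ne hkj] at hk
              by_cases hki : k = i
              · subst hki; exact ha
              · rwa [hu'k k hki] at hk) hi ha
              (fun _ => by rw [Function.update_of_ne hij]; exact hxi)) (Nat.lt_succ_iff.mp hm))
      linarith
    intro u I x hu hm
    by_cases h1 : ∀ i ∈ I, ∀ j ∈ I, ⟪x, u i⟫ ≠ 0 → ⟪x, u j⟫ ≠ 0 → i = j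
    · exact H u I x hu h1
    · push Not at h1
      obtain ⟨i, hi, j, hj, ha, hb, hij⟩ := h1
      rcases lt_or_gt_of_ne (div_ne_zero ha hb) with hq | hq
      · rcases div_neg_iff.mp hq with ⟨ha', hb'⟩ | ⟨ha', hb'⟩
        · exact opp u I x hu hm j hj i hi hij.symm hb' ha'
        · exact opp u I x hu hm i hi j hj hij ha' hb'
      · rcases lt_trichotomy (⟪x, u i⟫ / ⟪x, u j⟫) 1 with h | h | h
        · exact same u I x hu hm i hi j hj hij ha hq h
        · have hab : ⟪x, u i⟫ = ⟪x, u j⟫ := by rwa [div_eq_one_iff_eq hb] at h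
          obtain ⟨z, hz⟩ := exists_inner_eq hu (Pi.single j ⟪x, u j⟫)
          have hval : ∀ ε : ℝ, ∀ k, ⟪x + ε • z, u k⟫
              = ⟪x, u k⟫ * (1 + if k = j then ε else 0) := by
            intro ε k
            rw [inner_add_left, real_inner_smul_left, hz]
            by_cases hk : k = j
            · subst hk; simp; ring
            · simp [hk]
          have hpos : ∀ ε : ℝ, ε ∈ Set.Ioi (0 : ℝ) → g (hullZero u I) (x + ε • z) = 0 := by
            intro ε hε
            have hε' : (0 : ℝ) < ε := hε
            have h1ε : (0 : ℝ) < 1 + ε := by linarith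
            have hne : ∀ k, ⟪x + ε • z, u k⟫ ≠ 0 ↔ ⟪x, u k⟫ ≠ 0 := by
              intro k
              rw [hval]
              have : (1 + if k = j then ε else 0) ≠ 0 := by split_ifs <;> linarith
              simp [this]
            have hquot : ⟪x + ε • z, u i⟫ / ⟪x + ε • z, u j⟫ = 1 / (1 + ε) := by
              rw [hval, hval, if_neg hij, if_pos rfl, hab]; field_simp; ring
            refine same u I _ hu ?_ i hi j hj hij ((hne i).mpr ha) ?_ ?_
            · simp only [hne]; exact hm
            · rw [hquot]; positivity
            · rw [hquot, div_lt_one h1ε]; linarith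
          have hcont : Continuous fun ε : ℝ => g (hullZero u I) (x + ε • z) :=
            (hg.cont _ (isPolytope0_hullZero u I)).comp (by fun_prop)
          have hcl : IsClosed {ε : ℝ | g (hullZero u I) (x + ε • z) = 0} :=
            isClosed_eq hcont continuous_const
          have h0 : (0 : ℝ) ∈ closure (Set.Ioi (0 : ℝ)) := by rw [closure_Ioi]; simp
          have := hcl.closure_subset_iff.mpr hpos h0
          simpa using this
        · refine same u I x hu hm j hj i hi hij.symm hb ?_ ?_
          · rw [← inv_div]; positivity
          · rw [← inv_div]; exact inv_lt_one_of_one_lt₀ h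

lemma Admissible.low_single_smul {g : Set (Euc n) → Euc n → ℝ} (hg : Admissible g)
    {I : Finset (Fin n)} {i : Fin n} (h1 : low g I (Pi.single i 1) = 0)
    (h2 : low g I (Pi.single i (-1)) = 0) (s : ℝ) : low g I (Pi.single i s) = 0 := by
  rcases le_total 0 s with hs | hs
  · have : (Pi.single i s : Fin n → ℝ) = s • Pi.single i 1 := by
      rw [← Pi.single_smul]; simp
    rw [this, hg.low_smul I hs, h1, mul_zero]
  · have : (Pi.single i s : Fin n → ℝ) = (-s) • Pi.single i (-1) := by
      rw [← Pi.single_smul]; simp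
    rw [this, hg.low_smul I (by linarith), h2, mul_zero]

/-- Vanishing of an admissible functional on the lower-dimensional simplices with at most one
vertex of nonzero height. -/
lemma Admissible.eq_zero_of_low {g : Set (Euc n) → Euc n → ℝ} (hg : Admissible g) (hn : 2 ≤ n)
    {i₀ i₁ : Fin n} (h01 : i₀ ≠ i₁)
    (hs : ∀ s, low g {i₀} (Pi.single i₀ s) = 0) (ht : ∀ s, low g {i₀, i₁} (Pi.single i₀ s) = 0)
    {u : Fin n → Euc n} {I : Finset (Fin n)} {x : Euc n} (hu : vol n u ≠ 0) (hI : I ≠ Finset.univ)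
    (h : ∀ i ∈ I, ∀ j ∈ I, ⟪x, u i⟫ ≠ 0 → ⟪x, u j⟫ ≠ 0 → i = j) :
    g (hullZero u I) x = 0 := by
  set a : Fin n → ℝ := fun i => ⟪x, u i⟫ with ha
  rw [hg.eq_low hn hu hI (a := a) (fun i _ => rfl)]
  by_cases hz : ∀ i ∈ I, a i = 0
  · rw [hg.low_congr hn hI (b := (0 : ℝ) • a) (fun i hi => by simp [hz i hi]),
      hg.low_smul I le_rfl, zero_mul]
  · push Not at hz
    obtain ⟨i, hi, hai⟩ := hz
    have hne : ∀ j ∈ I, j ≠ i → a j = 0 := fun j hj hji => by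
      by_contra haj
      exact hji (h j hj i hi haj hai)
    by_cases hsing : ∀ j ∈ I, j = i
    · have hIi : I = {i} := Finset.eq_singleton_iff_unique_mem.mpr ⟨hi, hsing⟩
      rw [← hs (a i)]
      refine hg.low_perm hn hI (fun _ => i₀) ?_ ?_ ?_
      · rw [hIi]; simp
      · rw [hIi]; simp
      · intro k hk; rw [hsing k hk]; simp
    · push Not at hsing
      obtain ⟨j, hj, hji⟩ := hsing
      have hsubI : ({i, j} : Finset (Fin n)) ⊆ I := by
        intro k hk
        rw [Finset.mem_insert, Finset.mem_singleton] at hk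
        rcases hk with rfl | rfl <;> assumption
      rw [hg.low_reduce hn (J := {i, j}) hI hsubI]
      · rw [← ht (a i)]
        refine hg.low_pair hn hji.symm h01 (fun h => hI ?_) (by simp) ?_
        · exact Finset.eq_univ_of_forall fun k => hsubI (h ▸ Finset.mem_univ k)
        · rw [hne j hj hji]; simp [h01.symm]
      · intro k hk hkJ
        simp only [Finset.mem_insert, Finset.mem_singleton, not_or] at hkJ
        exact ⟨j, by simp, by rw [hne j hj hji, hne k hk hkJ.1]⟩

/-- The functional is `θ` times the volume on full simplices with one vertex at height `s` and the
others at height zero. -/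
def VolumeLinear (g : Set (Euc n) → Euc n → ℝ) (i : Fin n) (s θ : ℝ) : Prop :=
  ∀ (u : Fin n → Euc n) (x : Euc n), vol n u ≠ 0 →
    (∀ k, ⟪x, u k⟫ = (Pi.single i s : Fin n → ℝ) k) →
    g (hullZero u Finset.univ) x = |vol n u| * θ

lemma Admissible.exists_volumeLinear {g : Set (Euc n) → Euc n → ℝ} (hg : Admissible g) (hn : 2 ≤ n)
    {i₀ i₁ i₂ : Fin n} (h01 : i₀ ≠ i₁) (h02 : i₀ ≠ i₂) (h12 : i₁ ≠ i₂)
    (hs : ∀ s, low g {i₀} (Pi.single i₀ s) = 0) (ht : ∀ s, low g {i₀, i₁} (Pi.single i₀ s) = 0)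
    (s C : ℝ) (hC : ∀ (u : Fin n → Euc n) (x : Euc n), vol n u ≠ 0 →
      (∀ k, ⟪x, u k⟫ = (Pi.single i₀ s : Fin n → ℝ) k) → C ≤ g (hullZero u Finset.univ) x) :
    ∃ θ, VolumeLinear g i₀ s θ := by
  obtain ⟨θ, hθ⟩ := hg.exists_linear hn (a := Pi.single i₀ s) h12
    (by simp [h01.symm, h02.symm]) hC
  refine ⟨θ, fun u x hu hx => ?_⟩
  rw [hθ u x hu hx, low, hg.eq_zero_of_low hn h01 hs ht vol_std_ne_zero (erase_ne_univ i₂), zero_add]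
  intro i _ j _ hi hj
  rw [inner_toLp_std] at hi hj
  have : ∀ k, (Pi.single i₀ s : Fin n → ℝ) k ≠ 0 → k = i₀ := by
    intro k hk
    by_contra h
    simp [h] at hk
  rw [this i hi, this j hj]

/-- An admissible functional vanishing on a few normalised simplices vanishes on all simplices. -/
lemma Admissible.hullZero_eq_zero_of_normalized {g : Set (Euc n) → Euc n → ℝ} (hg : Admissible g)
    (hn : 2 ≤ n) {i₀ i₁ : Fin n} (h01 : i₀ ≠ i₁)
    (hs : ∀ s, low g {i₀} (Pi.single i₀ s) = 0) (ht : ∀ s, low g {i₀, i₁} (Pi.single i₀ s) = 0)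
    (h1 : VolumeLinear g i₀ 1 0) (h2 : VolumeLinear g i₀ (-1) 0)
    {u : Fin n → Euc n} (hu : vol n u ≠ 0) (I : Finset (Fin n)) (x : Euc n) :
    g (hullZero u I) x = 0 := by
  refine hg.hullZero_eq_zero (fun u I x hu h => ?_) hu I x
  by_cases hI : I = Finset.univ
  · subst hI
    by_cases hz : ∀ i, ⟪x, u i⟫ = 0
    · have hx : x = 0 := ext_inner_of_vol hu fun i => by rw [hz i, inner_zero_left]
      have := hg.hom _ (isPolytope0_hullZero u Finset.univ) 0 le_rfl x
      rw [zero_smul, zero_mul] at this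
      rw [hx, this]
    · push Not at hz
      obtain ⟨i, hi⟩ := hz
      have hne : ∀ j, j ≠ i → ⟪x, u j⟫ = 0 := fun j hji => by
        by_contra hj
        exact hji (h j (Finset.mem_univ _) i (Finset.mem_univ _) hj hi)
      set σ := Equiv.swap i₀ i with hσ
      have hsw : hullZero (u ∘ σ) Finset.univ = hullZero u Finset.univ := by
        have := hullZero_comp u σ.toEmbedding Finset.univ
        rw [Finset.map_univ_equiv] at this
        exact this
      have hv : vol n (u ∘ σ) ≠ 0 := by
        rw [AlternatingMap.map_perm]
        rcases Int.units_eq_one_or (Equiv.Perm.sign σ) with h | h <;> rw [h] <;> simpa using hu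
      have key : ∀ s : ℝ, s = 1 ∨ s = -1 → ∀ y : Euc n, (∀ k, k ≠ i → ⟪y, u k⟫ = 0) →
          ⟪y, u i⟫ = s → g (hullZero u Finset.univ) y = 0 := by
        intro s hs y hy hyi
        have hval : ∀ k, ⟪y, (u ∘ σ) k⟫ = (Pi.single i₀ s : Fin n → ℝ) k := by
          intro k
          by_cases hk : k = i₀
          · subst hk; simp [hσ, hyi]
          · rw [Function.comp_apply, hy, Pi.single_eq_of_ne hk]
            intro h
            have := σ.injective (h.trans (Equiv.swap_apply_left i₀ i).symm)
            exact hk this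
        rw [← hsw]
        rcases hs with rfl | rfl
        · rw [h1 _ _ hv hval, mul_zero]
        · rw [h2 _ _ hv hval, mul_zero]
      set c := |⟪x, u i⟫| with hc
      have hcpos : 0 < c := abs_pos.mpr hi
      have hx : x = c • (c⁻¹ • x) := by rw [smul_smul, mul_inv_cancel₀ hcpos.ne', one_smul]
      rw [hx, hg.hom _ (isPolytope0_hullZero u Finset.univ) c hcpos.le]
      rw [key (c⁻¹ * ⟪x, u i⟫) ?_ _ ?_ ?_, mul_zero]
      · rcases abs_cases ⟪x, u i⟫ with ⟨h, _⟩ | ⟨h, _⟩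
        · left; rw [hc, h]; field_simp
        · right; rw [hc, h]; field_simp
      · intro k hk
        rw [real_inner_smul_left, hne k hk, mul_zero]
      · rw [real_inner_smul_left]
  · exact hg.eq_zero_of_low hn h01 hs ht hu hI h

/-- The closed half-space with inner normal `a` whose boundary contains the origin. -/
def halfSpace (a : Euc n) : Set (Euc n) := {x | 0 ≤ ⟪a, x⟫}

lemma convex_halfSpace (a : Euc n) : Convex ℝ (halfSpace a) := by
  intro x hx y hy s t hs ht _
  simp only [halfSpace, Set.mem_ofPred_eq, inner_add_right, inner_smul_right] at *
  positivity

lemma isPolytope0_inter_halfSpace {P : Set (Euc n)} (hP : IsPolytope0 P) (a : Euc n) :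
    IsPolytope0 (P ∩ halfSpace a) := by
  obtain ⟨⟨S, rfl⟩, h0⟩ := hP
  set w : Euc n → Euc n → Euc n := fun s t =>
    (⟪a, t⟫ / (⟪a, t⟫ - ⟪a, s⟫)) • s + (-⟪a, s⟫ / (⟪a, t⟫ - ⟪a, s⟫)) • t with hw
  set N : Set (Euc n) := {s | s ∈ S ∧ 0 ≤ ⟪a, s⟫} ∪
    Set.image2 w {s | s ∈ S ∧ ⟪a, s⟫ < 0} {t | t ∈ S ∧ 0 < ⟪a, t⟫} with hN
  have hNfin : N.Finite := by
    refine Set.Finite.union (S.finite_toSet.subset fun s hs => hs.1) (Set.Finite.image2 _ ?_ ?_)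
    · exact S.finite_toSet.subset fun s hs => hs.1
    · exact S.finite_toSet.subset fun s hs => hs.1
  have heq : convexHull ℝ (S : Set (Euc n)) ∩ halfSpace a = convexHull ℝ N := by
    refine Set.Subset.antisymm ?_ ?_
    · rintro z ⟨hzS, hz⟩
      by_contra hzN
      obtain ⟨f, c, hfc, hcz⟩ := geometric_hahn_banach_closed_point (convex_convexHull ℝ N)
        (hNfin.isClosed_convexHull ℝ) hzN
      have hfN : ∀ y ∈ N, f y < c := fun y hy => hfc y (subset_convexHull ℝ N hy)
      have hpair : ∀ s ∈ S, ∀ t ∈ S, ⟪a, s⟫ < 0 → 0 < ⟪a, t⟫ →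
          ⟪a, t⟫ * f s + -⟪a, s⟫ * f t ≤ c * (⟪a, t⟫ - ⟪a, s⟫) := by
        intro s hs t ht has hat
        have hd : 0 < ⟪a, t⟫ - ⟪a, s⟫ := by linarith
        have := hfN (w s t) (Or.inr (Set.mem_image2_of_mem ⟨hs, has⟩ ⟨ht, hat⟩))
        simp only [hw, map_add, map_smul, smul_eq_mul] at this
        have h2 : ⟪a, t⟫ / (⟪a, t⟫ - ⟪a, s⟫) * f s + -⟪a, s⟫ / (⟪a, t⟫ - ⟪a, s⟫) * f t
          = (⟪a, t⟫ * f s + -⟪a, s⟫ * f t) / (⟪a, t⟫ - ⟪a, s⟫) := by ring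
        rw [h2, div_lt_iff₀ hd] at this
        exact this.le
      classical
      set Q : Finset ℝ := insert 0 ((S.filter fun s => ⟪a, s⟫ < 0).image
        fun s => (f s - c) / -⟪a, s⟫) with hQ
      obtain ⟨l, hlQ, hlmax⟩ := Q.exists_max_image id ⟨0, Finset.mem_insert_self _ _⟩
      have hl0 : 0 ≤ l := hlmax 0 (Finset.mem_insert_self _ _)
      have hle : ∀ y ∈ (S : Set (Euc n)), f y + l * ⟪a, y⟫ ≤ c := by
        intro y hy
        have hyS : y ∈ S := hy
        rcases lt_trichotomy ⟪a, y⟫ 0 with h | h | h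
        · have h1 := hlmax ((f y - c) / -⟪a, y⟫) (Finset.mem_insert_of_mem
            (Finset.mem_image_of_mem _ (Finset.mem_filter.mpr ⟨hyS, h⟩)))
          simp only [id] at h1
          rw [div_le_iff₀ (by linarith)] at h1
          linarith
        · have := hfN y (Or.inl ⟨hyS, h.ge⟩)
          rw [h, mul_zero, add_zero]
          exact this.le
        · rw [hQ, Finset.mem_insert] at hlQ
          rcases hlQ with rfl | hlQ
          · have := hfN y (Or.inl ⟨hyS, h.le⟩)
            linarith
          · obtain ⟨s, hs, rfl⟩ := Finset.mem_image.mp hlQ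
            obtain ⟨hsS, hs0⟩ := Finset.mem_filter.mp hs
            have := hpair s hsS y hyS hs0 h
            have hs1 : 0 < -⟪a, s⟫ := by linarith
            have e : f y + (f s - c) / -⟪a, s⟫ * ⟪a, y⟫
                = (-⟪a, s⟫ * f y + (f s - c) * ⟪a, y⟫) / -⟪a, s⟫ := by
              have := hs0.ne
              field_simp
              ring
            rw [e, div_le_iff₀ hs1]
            linarith
      have hconv : Convex ℝ {y : Euc n | f y + l * ⟪a, y⟫ ≤ c} := by
        intro x hx y hy p q hp hq hpq
        simp only [Set.mem_ofPred_eq, map_add, map_smul, smul_eq_mul, inner_add_right,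
          inner_smul_right] at *
        have : c = p * c + q * c := by rw [← add_mul, hpq, one_mul]
        nlinarith [mul_le_mul_of_nonneg_left hx hp, mul_le_mul_of_nonneg_left hy hq]
      have hzc : f z + l * ⟪a, z⟫ ≤ c := convexHull_min hle hconv hzS
      have : 0 ≤ l * ⟪a, z⟫ := mul_nonneg hl0 hz
      linarith
    · refine convexHull_min ?_ ((convex_convexHull ℝ _).inter (convex_halfSpace a))
      rintro z (⟨hz, h⟩ | ⟨s, ⟨hs, has⟩, t, ⟨ht, hat⟩, rfl⟩)
      · exact ⟨subset_convexHull ℝ _ hz, h⟩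
      · have hd : 0 < ⟪a, t⟫ - ⟪a, s⟫ := by linarith
        refine ⟨convex_convexHull ℝ _ (subset_convexHull ℝ _ hs) (subset_convexHull ℝ _ ht)
          (by positivity) (div_nonneg (by linarith) hd.le) ?_, ?_⟩
        · rw [← add_div, ← sub_eq_add_neg, div_self hd.ne']
        · simp only [halfSpace, hw, Set.mem_ofPred_eq, inner_add_right, inner_smul_right]
          apply le_of_eq
          ring
  rw [heq]
  refine isPolytope0_convexHull hNfin ?_
  rw [← heq]
  exact ⟨h0, by simp [halfSpace]⟩

/-- The polyhedral cone cut out by a list of half-spaces. -/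
def cone (A : List (Euc n)) : Set (Euc n) := {x | ∀ a ∈ A, 0 ≤ ⟪a, x⟫}

lemma cone_cons (a : Euc n) (A : List (Euc n)) : cone (a :: A) = halfSpace a ∩ cone A := by
  ext x; simp [cone, halfSpace]

lemma isPolytope0_inter_cone {P : Set (Euc n)} (hP : IsPolytope0 P) (A : List (Euc n)) :
    IsPolytope0 (P ∩ cone A) := by
  induction A generalizing P with
  | nil => simpa [cone] using hP
  | cons a A ih =>
    rw [cone_cons, ← Set.inter_assoc]
    exact ih (isPolytope0_inter_halfSpace hP a)

/-- Real-valued valuations on polytopes containing the origin. -/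
def IsValuation0 (D : Set (Euc n) → ℝ) : Prop :=
  ∀ K L : Set (Euc n), IsPolytope0 K → IsPolytope0 L → IsPolytope0 (K ∪ L) →
    IsPolytope0 (K ∩ L) → D (K ∪ L) + D (K ∩ L) = D K + D L

lemma hullZero_subset_halfSpace {u : Fin n → Euc n} {I : Finset (Fin n)} {a : Euc n}
    (h : ∀ i ∈ I, 0 ≤ ⟪a, u i⟫) : hullZero u I ⊆ halfSpace a := by
  refine convexHull_min ?_ (convex_halfSpace a)
  rintro x (rfl | ⟨i, hi, rfl⟩)
  · simp [halfSpace]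
  · exact h i hi

lemma hullZero_inter_halfSpace {u : Fin n → Euc n} {I : Finset (Fin n)} {a : Euc n}
    (h : ∀ i ∈ I, ⟪a, u i⟫ ≤ 0) :
    hullZero u I ∩ halfSpace a = hullZero u (I.filter fun i => ⟪a, u i⟫ = 0) := by
  ext z
  rw [Set.mem_inter_iff, mem_hullZero, mem_hullZero]
  constructor
  · rintro ⟨⟨c, hc0, hcI, hc1, rfl⟩, hz⟩
    refine ⟨c, hc0, fun i hi => ?_, hc1, rfl⟩
    by_cases hiI : i ∈ I
    · simp only [halfSpace, Set.mem_ofPred_eq, inner_sum, inner_smul_right] at hz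
      have hnp : ∀ k ∈ Finset.univ, c k * ⟪a, u k⟫ ≤ 0 := by
        intro k _
        by_cases hk : k ∈ I
        · exact mul_nonpos_of_nonneg_of_nonpos (hc0 k) (h k hk)
        · rw [hcI k hk, zero_mul]
      have h0 := (Finset.sum_eq_zero_iff_of_nonpos hnp).mp
        (le_antisymm (Finset.sum_nonpos hnp) hz) i (Finset.mem_univ _)
      rcases mul_eq_zero.mp h0 with h1 | h1
      · exact h1
      · exact absurd (Finset.mem_filter.mpr ⟨hiI, h1⟩) hi
    · exact hcI i hiI
  · rintro ⟨c, hc0, hcI, hc1, rfl⟩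
    refine ⟨⟨c, hc0, fun i hi => hcI i fun h' => hi (Finset.mem_filter.mp h').1, hc1, rfl⟩, ?_⟩
    simp only [halfSpace, Set.mem_ofPred_eq, inner_sum, inner_smul_right]
    refine Finset.sum_nonneg fun i _ => ?_
    by_cases hi : i ∈ I.filter fun i => ⟪a, u i⟫ = 0
    · rw [(Finset.mem_filter.mp hi).2, mul_zero]
    · rw [hcI i hi, zero_mul]

/-- A valuation vanishing on simplices vanishes on the pieces cut out of simplices by cones. -/
lemma IsValuation0.simplex_inter_cone {D : Set (Euc n) → ℝ} (hD : IsValuation0 D)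
    (h0 : ∀ (u : Fin n → Euc n) (I : Finset (Fin n)), vol n u ≠ 0 → D (hullZero u I) = 0)
    (A : List (Euc n)) : ∀ (u : Fin n → Euc n) (I : Finset (Fin n)), vol n u ≠ 0 →
      D (hullZero u I ∩ cone A) = 0 := by
  induction A with
  | nil => intro u I hu; simpa [cone] using h0 u I hu
  | cons a A ihA =>
    suffices h : ∀ (m : ℕ) (u : Fin n → Euc n) (I : Finset (Fin n)), vol n u ≠ 0 →
        (I.filter fun i => ⟪a, u i⟫ ≠ 0).card < m → D (hullZero u I ∩ cone (a :: A)) = 0 from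
      fun u I hu => h _ u I hu (Nat.lt_succ_self _)
    intro m
    induction m with
    | zero => intro u I _ h; exact absurd h (Nat.not_lt_zero _)
    | succ m ih =>
      intro u I hu hm
      by_cases hneg : ∃ i ∈ I, ⟪a, u i⟫ < 0
      · obtain ⟨i, hi, hai⟩ := hneg
        by_cases hpos : ∃ j ∈ I, 0 < ⟪a, u j⟫
        · obtain ⟨j, hj, haj⟩ := hpos
          have hij : i ≠ j := by rintro rfl; linarith
          have hd : 0 < ⟪a, u j⟫ - ⟪a, u i⟫ := by linarith
          have ht0 : 0 < ⟪a, u j⟫ / (⟪a, u j⟫ - ⟪a, u i⟫) := by positivity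
          have ht1 : ⟪a, u j⟫ / (⟪a, u j⟫ - ⟪a, u i⟫) < 1 := by rw [div_lt_one hd]; linarith
          have hU := hullZero_update_union (u := u) hi hj hij ht0 ht1
          have hN := hullZero_update_inter hu hi hj hij ht0 ht1
          have ht : (⟪a, u j⟫ / (⟪a, u j⟫ - ⟪a, u i⟫)) * ⟪a, u i⟫ +
              (1 - ⟪a, u j⟫ / (⟪a, u j⟫ - ⟪a, u i⟫)) * ⟪a, u j⟫ = 0 := by field_simp; ring
          set t := ⟪a, u j⟫ / (⟪a, u j⟫ - ⟪a, u i⟫)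
          set w := t • u i + (1 - t) • u j with hw
          have haw : ⟪a, w⟫ = 0 := by
            rw [hw, inner_add_right, inner_smul_right, inner_smul_right, ht]
          have hvi : vol n (Function.update u i w) ≠ 0 := by
            rw [hw, vol_update_left _ hij]; exact mul_ne_zero ht0.ne' hu
          have hvj : vol n (Function.update u j w) ≠ 0 := by
            rw [hw, vol_update_right _ hij]; exact mul_ne_zero (by linarith) hu
          have hval : ∀ l k, ⟪a, Function.update u l w k⟫ ≠ 0 → ⟪a, u k⟫ ≠ 0 := by
            intro l k hk
            by_cases hkl : k = l
            · subst hkl; rw [Function.update_self] at hk; exact absurd haw hk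
            · rwa [Function.update_of_ne hkl] at hk
          have e1 := ih _ (I.erase j) hvi (lt_of_lt_of_le (card_filter_inner_lt
            (Finset.erase_subset _ _) (fun k _ => hval i k) hi hai.ne
            (fun _ => by simp [haw])) (Nat.lt_succ_iff.mp hm))
          have e2 := ih _ I hvi (lt_of_lt_of_le (card_filter_inner_lt subset_rfl
            (fun k _ => hval i k) hi hai.ne (fun _ => by simp [haw])) (Nat.lt_succ_iff.mp hm))
          have e3 := ih _ I hvj (lt_of_lt_of_le (card_filter_inner_lt subset_rfl
            (fun k _ => hval j k) hj haj.ne' (fun _ => by simp [haw])) (Nat.lt_succ_iff.mp hm))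
          have h := hD (hullZero (Function.update u j w) I ∩ cone (a :: A))
            (hullZero (Function.update u i w) I ∩ cone (a :: A))
            (isPolytope0_inter_cone (isPolytope0_hullZero _ _) _) (isPolytope0_inter_cone (isPolytope0_hullZero _ _) _)
          rw [← Set.union_inter_distrib_right, ← Set.inter_inter_distrib_right, hU, hN] at h
          have h := h (isPolytope0_inter_cone (isPolytope0_hullZero _ _) _)
            (isPolytope0_inter_cone (isPolytope0_hullZero _ _) _)
          linarith
        · push Not at hpos
          rw [cone_cons, ← Set.inter_assoc, hullZero_inter_halfSpace hpos]
          exact ihA u _ hu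
      · push Not at hneg
        rw [cone_cons, ← Set.inter_assoc,
          Set.inter_eq_left.mpr (hullZero_subset_halfSpace hneg)]
        exact ihA u I hu

/-- Sets defined by finitely many homogeneous linear inequalities. -/
def IsHCone {E : Type*} [AddCommGroup E] [Module ℝ E] (X : Set E) : Prop :=
  ∃ L : Set (E →ₗ[ℝ] ℝ), L.Finite ∧ X = {x | ∀ l ∈ L, 0 ≤ l x}

lemma isHCone_zero {E : Type*} [AddCommGroup E] [Module ℝ E] [FiniteDimensional ℝ E] :
    IsHCone ({0} : Set E) := by
  set b := Module.finBasis ℝ E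
  refine ⟨Set.range b.coord ∪ Set.range fun i => -b.coord i,
    (Set.finite_range _).union (Set.finite_range _), ?_⟩
  ext x
  simp only [Set.mem_singleton_iff, Set.mem_ofPred_eq]
  constructor
  · rintro rfl l _
    simp
  · intro h
    refine b.ext_elem fun i => ?_
    have h1 := h _ (Or.inl ⟨i, rfl⟩)
    have h2 := h _ (Or.inr ⟨i, rfl⟩)
    simp only [LinearMap.neg_apply, Module.Basis.coord_apply] at h1 h2
    rw [map_zero, Finsupp.zero_apply]
    linarith

/-- Fourier–Motzkin elimination. -/
lemma IsHCone.add_ray {E : Type*} [AddCommGroup E] [Module ℝ E] {X : Set E} (hX : IsHCone X)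
    (v : E) : IsHCone {x | ∃ t : ℝ, 0 ≤ t ∧ x - t • v ∈ X} := by
  classical
  obtain ⟨L, hL, rfl⟩ := hX
  refine ⟨{l | l ∈ L ∧ 0 ≤ l v} ∪ Set.image2 (fun l m => l v • m - m v • l)
    {l | l ∈ L ∧ 0 < l v} {m | m ∈ L ∧ m v < 0}, ?_, ?_⟩
  · exact (hL.subset fun l hl => hl.1).union
      ((hL.subset fun l hl => hl.1).image2 _ (hL.subset fun l hl => hl.1))
  ext x
  simp only [Set.mem_ofPred_eq, map_sub, map_smul, smul_eq_mul]
  constructor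
  · rintro ⟨t, ht, h⟩ l (⟨hl, hlv⟩ | ⟨l, ⟨hl, hlv⟩, m, ⟨hm, hmv⟩, rfl⟩)
    · have := h l hl
      have := mul_nonneg ht hlv
      linarith
    · have h1 := mul_nonneg hlv.le (h m hm)
      have h2 := mul_nonneg (neg_nonneg.mpr hmv.le) (h l hl)
      simp only [LinearMap.sub_apply, LinearMap.smul_apply, smul_eq_mul]
      nlinarith
  · intro h
    set Q : Finset ℝ := insert 0 ((hL.toFinset.filter fun m => m v < 0).image fun m => m x / m v)
      with hQ
    obtain ⟨t, htQ, htmax⟩ := Q.exists_max_image id ⟨0, Finset.mem_insert_self _ _⟩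
    refine ⟨t, htmax 0 (Finset.mem_insert_self _ _), fun l hl => ?_⟩
    rcases lt_or_ge (l v) 0 with hlv | hlv
    · have := htmax (l x / l v) (Finset.mem_insert_of_mem (Finset.mem_image_of_mem _
        (Finset.mem_filter.mpr ⟨hL.mem_toFinset.mpr hl, hlv⟩)))
      simp only [id] at this
      rw [div_le_iff_of_neg hlv] at this
      linarith
    · have hlx := h l (Or.inl ⟨hl, hlv⟩)
      rw [hQ, Finset.mem_insert] at htQ
      rcases htQ with rfl | htQ
      · simpa using hlx
      · obtain ⟨m, hm, rfl⟩ := Finset.mem_image.mp htQ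
        obtain ⟨hmL, hmv⟩ := Finset.mem_filter.mp hm
        rcases hlv.eq_or_lt with h0 | h0
        · rw [← h0, mul_zero, sub_zero]; exact hlx
        · have := h _ (Or.inr (Set.mem_image2_of_mem ⟨hl, h0⟩ ⟨hL.mem_toFinset.mp hmL, hmv⟩))
          simp only [LinearMap.sub_apply, LinearMap.smul_apply, smul_eq_mul] at this
          have e : l x - m x / m v * l v = (l v * m x - m v * l x) / -m v := by
            have := hmv.ne
            field_simp
            ring
          rw [e]
          exact div_nonneg this (by linarith)

lemma isHCone_conicSpan {E ι : Type*} [AddCommGroup E] [Module ℝ E] [FiniteDimensional ℝ E]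
    (S : Finset ι) (v : ι → E) :
    IsHCone {z | ∃ c : ι → ℝ, (∀ s ∈ S, 0 ≤ c s) ∧ ∑ s ∈ S, c s • v s = z} := by
  classical
  induction S using Finset.induction_on with
  | empty =>
    convert isHCone_zero (E := E) using 1
    ext x
    simp [eq_comm]
  | insert s S hs ih =>
    convert ih.add_ray (v s) using 1
    ext z
    simp only [Set.mem_ofPred_eq]
    constructor
    · rintro ⟨c, hc, rfl⟩
      refine ⟨c s, hc s (Finset.mem_insert_self _ _), c,
        fun i hi => hc i (Finset.mem_insert_of_mem hi), ?_⟩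
      rw [Finset.sum_insert hs, add_sub_cancel_left]
    · rintro ⟨t, ht, c, hc, h⟩
      refine ⟨Function.update c s t, fun i hi => ?_, ?_⟩
      · by_cases his : i = s
        · subst his; simpa using ht
        · rw [Function.update_of_ne his]
          exact hc i (Finset.mem_of_mem_insert_of_ne hi his)
      · rw [Finset.sum_insert hs, Function.update_self, Finset.sum_congr rfl fun i hi => by
          rw [Function.update_of_ne (ne_of_mem_of_not_mem hi hs)], h]
        abel

/-- The polyhedron with homogeneous constraints `A` and constraints `G` of level one. -/
def polyhedron (A G : List (Euc n)) : Set (Euc n) := {x | x ∈ cone A ∧ ∀ g ∈ G, ⟪g, x⟫ ≤ 1}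

/-- Polytopes containing the origin are polyhedra. -/
lemma exists_eq_polyhedron {P : Set (Euc n)} (hP : IsPolytope0 P) :
    ∃ A G : List (Euc n), P = polyhedron A G := by
  classical
  obtain ⟨⟨S, rfl⟩, h0⟩ := hP
  obtain ⟨L, hL, hLeq⟩ := isHCone_conicSpan S fun s : Euc n => ((s, 1) : Euc n × ℝ)
  have hmem : ∀ x : Euc n, x ∈ convexHull ℝ (S : Set (Euc n)) ↔ ∀ l ∈ L, 0 ≤ l (x, 1) := by
    intro x
    have : (∀ l ∈ L, 0 ≤ l (x, 1)) ↔ ((x, 1) : Euc n × ℝ) ∈ {x | ∀ l ∈ L, 0 ≤ l x} := Iff.rfl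
    rw [this, ← hLeq, Finset.mem_convexHull']
    simp only [Set.mem_ofPred_eq, Prod.ext_iff, Prod.fst_sum, Prod.snd_sum, Prod.smul_mk,
      smul_eq_mul, mul_one]
    constructor
    · rintro ⟨w, h1, h2, h3⟩; exact ⟨w, h1, h3, h2⟩
    · rintro ⟨w, h1, h2, h3⟩; exact ⟨w, h1, h3, h2⟩
  set r : (Euc n × ℝ →ₗ[ℝ] ℝ) → Euc n := fun l => (InnerProductSpace.toDual ℝ (Euc n)).symm
    (LinearMap.toContinuousLinearMap (l ∘ₗ LinearMap.inl ℝ (Euc n) ℝ)) with hr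
  have hl : ∀ l : Euc n × ℝ →ₗ[ℝ] ℝ, ∀ x, l (x, 1) = ⟪r l, x⟫ + l (0, 1) := by
    intro l x
    rw [hr]
    simp only [InnerProductSpace.toDual_symm_apply, LinearMap.coe_toContinuousLinearMap',
      LinearMap.comp_apply, LinearMap.inl_apply]
    rw [← map_add]
    simp
  have hnn : ∀ l ∈ L, 0 ≤ l (0, 1) := (hmem 0).mp h0
  refine ⟨(hL.toFinset.filter fun l => l (0, 1) = 0).toList.map r,
    (hL.toFinset.filter fun l => l (0, 1) ≠ 0).toList.map fun l => -((l (0, 1))⁻¹ • r l), ?_⟩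
  ext x
  rw [hmem]
  simp only [polyhedron, cone, Set.mem_ofPred_eq, List.forall_mem_map, Finset.mem_toList,
    Finset.mem_filter, Set.Finite.mem_toFinset]
  constructor
  · intro h
    refine ⟨fun l ⟨hlL, hl0⟩ => ?_, fun l ⟨hlL, hl0⟩ => ?_⟩
    · have := h l hlL
      rwa [hl, hl0, add_zero] at this
    · have hpos := (hnn l hlL).lt_of_ne' hl0
      have := h l hlL
      rw [hl] at this
      rw [inner_neg_left, real_inner_smul_left, neg_le, ← mul_le_mul_iff_right₀ hpos,
        mul_inv_cancel_left₀ hl0]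
      linarith
  · rintro ⟨h1, h2⟩ l hlL
    rw [hl]
    by_cases hl0 : l (0, 1) = 0
    · rw [hl0, add_zero]; exact h1 l ⟨hlL, hl0⟩
    · have hpos := (hnn l hlL).lt_of_ne' hl0
      have := h2 l ⟨hlL, hl0⟩
      rw [inner_neg_left, real_inner_smul_left, neg_le, ← mul_le_mul_iff_right₀ hpos,
        mul_inv_cancel_left₀ hl0] at this
      linarith

/-- A simplex with a vertex at the origin, described by the dual basis of its edges. -/
lemma exists_hullZero_eq {a : Fin n → Euc n} (ha : ∀ x, (∀ i, ⟪a i, x⟫ = 0) → x = 0) :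
    ∃ u : Fin n → Euc n, vol n u ≠ 0 ∧
      hullZero u Finset.univ = {x | (∀ i, 0 ≤ ⟪a i, x⟫) ∧ ⟪∑ i, a i, x⟫ ≤ 1} := by
  set f : Euc n →ₗ[ℝ] (Fin n → ℝ) := LinearMap.pi fun i => (innerₗ (Euc n)) (a i) with hf
  have hfa : ∀ x i, f x i = ⟪a i, x⟫ := fun x i => rfl
  have hinj : Function.Injective f := by
    rw [injective_iff_map_eq_zero]
    intro x hx
    exact ha x fun i => by rw [← hfa, hx]; rfl
  set e : Euc n ≃ₗ[ℝ] (Fin n → ℝ) := LinearMap.linearEquivOfInjective f hinj (by simp)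
  have he : ∀ x, e x = f x := fun x => LinearMap.linearEquivOfInjective_apply _ _ x
  set b := (Pi.basisFun ℝ (Fin n)).map e.symm with hb
  have hab : ∀ (c : Fin n → ℝ) i, ⟪a i, ∑ j, c j • b j⟫ = c i := by
    intro c i
    rw [← hfa, ← he, map_sum]
    simp [hb, Finset.sum_apply, Pi.single_apply]
  refine ⟨b, vol_ne_zero_of_linearIndependent b.linearIndependent, ?_⟩
  ext x
  rw [mem_hullZero]
  simp only [Finset.mem_univ, not_true_eq_false, false_imp_iff, implies_true, true_and,
    Set.mem_ofPred_eq, sum_inner]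
  constructor
  · rintro ⟨c, hc0, hc1, rfl⟩
    simp only [hab]
    exact ⟨hc0, hc1⟩
  · rintro ⟨h0, h1⟩
    refine ⟨fun i => ⟪a i, x⟫, h0, h1, hinj ?_⟩
    funext i
    rw [hfa, hfa, hab]

lemma cone_smul_mem {A : List (Euc n)} {x : Euc n} (hx : x ∈ cone A) {t : ℝ} (ht : 0 ≤ t) :
    t • x ∈ cone A := by
  intro a ha
  rw [inner_smul_right]
  exact mul_nonneg ht (hx a ha)

lemma norm_le_of_bounded_polyhedron {A : List (Euc n)} {g : Euc n} {R : ℝ}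
    (hR : ∀ x ∈ polyhedron A [g], ‖x‖ ≤ R) {x : Euc n} (hx : x ∈ cone A) : ‖x‖ ≤ R * ⟪g, x⟫ := by
  rcases le_or_gt ⟪g, x⟫ 0 with h | h
  · have hx0 : x = 0 := by
      by_contra hne
      have hpos : 0 < ‖x‖ := norm_pos_iff.mpr hne
      have h0 : 0 ≤ R := (norm_nonneg _).trans (hR 0 ⟨by simp [cone], by simp⟩)
      have ht : 0 ≤ (R + 1) / ‖x‖ := by positivity
      have := hR (((R + 1) / ‖x‖) • x) ⟨cone_smul_mem hx ht, by
        simp only [List.mem_singleton, forall_eq, inner_smul_right]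
        exact (mul_nonpos_of_nonneg_of_nonpos ht h).trans zero_le_one⟩
      rw [norm_smul, Real.norm_of_nonneg ht, div_mul_cancel₀ _ hpos.ne'] at this
      linarith
    simp [hx0]
  · have := hR (⟪g, x⟫⁻¹ • x) ⟨cone_smul_mem hx (inv_nonneg.mpr h.le), by
      simp [inner_smul_right, h.ne']⟩
    rw [norm_smul, Real.norm_of_nonneg (inv_nonneg.mpr h.le), inv_mul_le_iff₀ h] at this
    linarith

lemma IsValuation0.polyhedron_singleton {D : Set (Euc n) → ℝ} (hD : IsValuation0 D)
    (h0 : ∀ (u : Fin n → Euc n) (I : Finset (Fin n)), vol n u ≠ 0 → D (hullZero u I) = 0)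
    (A : List (Euc n)) (g : Euc n) (hP : IsPolytope0 (polyhedron A [g])) :
    D (polyhedron A [g]) = 0 := by
  obtain ⟨R, hRpos, hR⟩ : ∃ R : ℝ, 0 < R ∧ ∀ x ∈ polyhedron A [g], ‖x‖ ≤ R := by
    obtain ⟨⟨S, hS⟩, -⟩ := hP
    have hb : Bornology.IsBounded (polyhedron A [g]) := by
      rw [hS]; exact (isBounded_convexHull.mpr S.finite_toSet.isBounded)
    exact hb.exists_pos_norm_le
  have hn := fun x => norm_le_of_bounded_polyhedron (x := x) hR
  by_cases hg : g = 0
  · have : polyhedron A [g] = hullZero (EuclideanSpace.basisFun (Fin n) ℝ) ∅ := by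
      ext x
      simp only [hullZero, Finset.coe_empty, Set.image_empty, insert_empty_eq,
        convexHull_singleton, Set.mem_singleton_iff]
      constructor
      · intro hx
        have := hn x hx.1
        rw [hg, inner_zero_left, mul_zero] at this
        exact norm_le_zero_iff.mp this
      · rintro rfl
        exact ⟨by simp [cone], by simp⟩
    rw [this]
    exact h0 _ _ (by rw [vol_std]; exact one_ne_zero)
  obtain ⟨k, hk⟩ : ∃ k, g k ≠ 0 := by
    by_contra! h
    exact hg (by ext i; simpa using h i)
  have hnpos : (0 : ℝ) < n := by
    exact_mod_cast (Fin.pos k)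
  set ε : ℝ := 1 / (n ^ 2 * R) with hε
  have hεpos : 0 < ε := by positivity
  set E : Fin n → Euc n := ⇑(EuclideanSpace.basisFun (Fin n) ℝ) with hE
  have hEx : ∀ i x, ⟪E i, x⟫ = x i := by
    intro i x
    simp [hE, EuclideanSpace.inner_single_left]
  set p : Fin n → Euc n := fun i => ε • E i + (1 / (n : ℝ)) • g with hp
  have hpx : ∀ i x, ⟪p i, x⟫ = ε * x i + 1 / n * ⟪g, x⟫ := by
    intro i x
    simp only [hp, inner_add_left, real_inner_smul_left, hEx]
  set a : Fin n → Euc n := Function.update p k (g - ∑ i ∈ Finset.univ.erase k, p i) with ha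
  have hak : a k = g - ∑ i ∈ Finset.univ.erase k, p i := Function.update_self ..
  have hai : ∀ i, i ≠ k → a i = p i := fun i hi => Function.update_of_ne hi ..
  have hsum : ∑ i, a i = g := by
    rw [← Finset.add_sum_erase _ _ (Finset.mem_univ k), hak,
      Finset.sum_congr rfl fun i hi => hai i (Finset.ne_of_mem_erase hi), sub_add_cancel]
  have hzero : ∀ x, (∀ i, ⟪a i, x⟫ = 0) → x = 0 := by
    intro x hx
    have hgx : ⟪g, x⟫ = 0 := by rw [← hsum, sum_inner]; simp [hx]
    have hxi : ∀ i, i ≠ k → x i = 0 := by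
      intro i hi
      have := hx i
      rw [hai i hi, hpx, hgx, mul_zero, add_zero] at this
      exact (mul_eq_zero.mp this).resolve_left hεpos.ne'
    have hxk : x k = 0 := by
      rw [PiLp.inner_apply, Finset.sum_eq_single k (fun i _ hi => by simp [hxi i hi])
        (by simp)] at hgx
      simpa [hk] using hgx
    ext i
    by_cases hi : i = k
    · rw [hi, hxk]; rfl
    · rw [hxi i hi]; rfl
  obtain ⟨u, hu, hT⟩ := exists_hullZero_eq hzero
  have hcone : ∀ x ∈ cone A, ∀ i, 0 ≤ ⟪a i, x⟫ := by
    intro x hx i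
    have hxn := hn x hx
    have hgx : 0 ≤ ⟪g, x⟫ := by
      have := (norm_nonneg _).trans hxn
      exact nonneg_of_mul_nonneg_right this hRpos
    have hxi : ∀ j, |x j| ≤ R * ⟪g, x⟫ := fun j =>
      (Real.norm_eq_abs _ ▸ PiLp.norm_apply_le x j).trans hxn
    have hεR : ε * (R * ⟪g, x⟫) = 1 / n ^ 2 * ⟪g, x⟫ := by
      rw [hε]; field_simp
    have hεx : ∀ j, |ε * x j| ≤ 1 / n ^ 2 * ⟪g, x⟫ := by
      intro j
      rw [abs_mul, abs_of_pos hεpos, ← hεR]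
      exact mul_le_mul_of_nonneg_left (hxi j) hεpos.le
    by_cases hi : i = k
    · rw [hi, hak, inner_sub_left, sum_inner]
      have h1 : ∑ j ∈ Finset.univ.erase k, ⟪p j, x⟫ ≤
          ∑ j ∈ Finset.univ.erase k, (1 / n ^ 2 + 1 / n) * ⟪g, x⟫ := by
        refine Finset.sum_le_sum fun j _ => ?_
        rw [hpx, add_mul]
        have := (abs_le.mp (hεx j)).2
        linarith
      rw [Finset.sum_const, Finset.card_erase_of_mem (Finset.mem_univ _), Finset.card_univ,
        Fintype.card_fin, nsmul_eq_mul, Nat.cast_sub (Fin.pos k), Nat.cast_one] at h1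
      have h2 : ((n : ℝ) - 1) * ((1 / n ^ 2 + 1 / n) * ⟪g, x⟫) =
          ⟪g, x⟫ - 1 / n ^ 2 * ⟪g, x⟫ := by
        field_simp
        ring
      have h3 : 0 ≤ 1 / (n : ℝ) ^ 2 * ⟪g, x⟫ := by positivity
      linarith
    · rw [hai i hi, hpx]
      have h1 := (abs_le.mp (hεx i)).1
      have h2 : 1 / (n : ℝ) ^ 2 * ⟪g, x⟫ ≤ 1 / n * ⟪g, x⟫ := by
        refine mul_le_mul_of_nonneg_right ?_ hgx
        have : (1 : ℝ) ≤ n := by exact_mod_cast Fin.pos k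
        exact one_div_le_one_div_of_le hnpos (by nlinarith)
      linarith
  have : polyhedron A [g] = hullZero u Finset.univ ∩ cone A := by
    rw [hT, hsum]
    ext x
    simp only [polyhedron, List.mem_singleton, forall_eq, Set.mem_ofPred_eq, Set.mem_inter_iff]
    exact ⟨fun h => ⟨⟨hcone x h.1, h.2⟩, h.1⟩, fun h => ⟨h.2, h.1.2⟩⟩
  rw [this]
  exact hD.simplex_inter_cone h0 A u _ hu

lemma IsValuation0.polyhedron_cons {D : Set (Euc n) → ℝ} (hD : IsValuation0 D)
    (h0 : ∀ (u : Fin n → Euc n) (I : Finset (Fin n)), vol n u ≠ 0 → D (hullZero u I) = 0)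
    (G : List (Euc n)) : ∀ (A : List (Euc n)) (g : Euc n), IsPolytope0 (polyhedron A (g :: G)) →
      D (polyhedron A (g :: G)) = 0 := by
  induction G with
  | nil => exact hD.polyhedron_singleton h0
  | cons g' G ih =>
    intro A g hP
    set K := polyhedron A (g :: g' :: G) with hK
    have e1 : K ∩ halfSpace (g - g') = polyhedron ((g - g') :: A) (g :: G) := by
      ext x
      simp only [hK, polyhedron, cone, halfSpace, List.forall_mem_cons, Set.mem_inter_iff,
        Set.mem_ofPred_eq, inner_sub_left]
      constructor
      · rintro ⟨⟨h1, h2, h3, h4⟩, h5⟩; exact ⟨⟨h5, h1⟩, h2, h4⟩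
      · rintro ⟨⟨h5, h1⟩, h2, h4⟩; exact ⟨⟨h1, h2, by linarith, h4⟩, h5⟩
    have e2 : K ∩ halfSpace (-(g - g')) = polyhedron (-(g - g') :: A) (g' :: G) := by
      ext x
      simp only [hK, polyhedron, cone, halfSpace, List.forall_mem_cons, Set.mem_inter_iff,
        Set.mem_ofPred_eq, inner_sub_left, inner_neg_left]
      constructor
      · rintro ⟨⟨h1, h2, h3, h4⟩, h5⟩; exact ⟨⟨h5, h1⟩, h3, h4⟩
      · rintro ⟨⟨h5, h1⟩, h2, h4⟩; exact ⟨⟨h1, by linarith, h2, h4⟩, h5⟩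
    have e3 : K ∩ halfSpace (g - g') ∩ (K ∩ halfSpace (-(g - g')))
        = polyhedron ((g - g') :: -(g - g') :: A) (g :: G) := by
      ext x
      simp only [hK, polyhedron, cone, halfSpace, List.forall_mem_cons, Set.mem_inter_iff,
        Set.mem_ofPred_eq, inner_sub_left, inner_neg_left]
      constructor
      · rintro ⟨⟨⟨h1, h2, h3, h4⟩, h5⟩, -, h6⟩; exact ⟨⟨h5, h6, h1⟩, h2, h4⟩
      · rintro ⟨⟨h5, h6, h1⟩, h2, h4⟩
        have h7 : ⟪g', x⟫ ≤ 1 := by linarith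
        exact ⟨⟨⟨h1, h2, h7, h4⟩, h5⟩, ⟨h1, h2, h7, h4⟩, h6⟩
    have e4 : K ∩ halfSpace (g - g') ∪ (K ∩ halfSpace (-(g - g'))) = K := by
      rw [← Set.inter_union_distrib_left, Set.inter_eq_left]
      intro x _
      simp only [halfSpace, Set.mem_union, Set.mem_ofPred_eq, inner_neg_left,
        Left.nonneg_neg_iff]
      exact le_total _ _
    have p1 := isPolytope0_inter_halfSpace hP (g - g')
    have p2 := isPolytope0_inter_halfSpace hP (-(g - g'))
    have p3 : IsPolytope0 (K ∩ halfSpace (g - g') ∩ (K ∩ halfSpace (-(g - g')))) := by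
      rw [Set.inter_inter_inter_comm, Set.inter_self, ← Set.inter_assoc]
      exact isPolytope0_inter_halfSpace p1 _
    have h := hD _ _ p1 p2 (by rwa [e4]) p3
    rw [e4, e3, e2, e1] at h
    rw [e1] at p1
    rw [e2] at p2
    rw [e3] at p3
    rw [ih _ _ p1, ih _ _ p2, ih _ _ p3] at h
    linarith

/-- A valuation vanishing on simplices with a vertex at the origin vanishes. -/
lemma IsValuation0.eq_zero {D : Set (Euc n) → ℝ} (hD : IsValuation0 D)
    (h0 : ∀ (u : Fin n → Euc n) (I : Finset (Fin n)), vol n u ≠ 0 → D (hullZero u I) = 0)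
    {P : Set (Euc n)} (hP : IsPolytope0 P) : D P = 0 := by
  obtain ⟨A, G, rfl⟩ := exists_eq_polyhedron hP
  cases G with
  | nil =>
    have : polyhedron A [] = polyhedron A [0] := by simp [polyhedron]
    rw [this] at hP ⊢
    exact hD.polyhedron_singleton h0 A 0 hP
  | cons g G => exact hD.polyhedron_cons h0 G A g hP

lemma isCompact_of_isPolytope0 {P : Set (Euc n)} (hP : IsPolytope0 P) : IsCompact P := by
  obtain ⟨⟨S, rfl⟩, -⟩ := hP
  exact S.finite_toSet.isCompact_convexHull ℝ

lemma isConvexBody0_of_isPolytope0 {P : Set (Euc n)} (hP : IsPolytope0 P) : IsConvexBody0 P := by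
  refine ⟨isCompact_of_isPolytope0 hP, ?_, hP.2⟩
  obtain ⟨⟨S, rfl⟩, -⟩ := hP
  exact convex_convexHull ℝ _

lemma inner_le_supp {K : Set (Euc n)} (hK : IsCompact K) (x : Euc n) {y : Euc n} (hy : y ∈ K) :
    ⟪x, y⟫ ≤ supp K x :=
  le_csSup (hK.image (by fun_prop : Continuous fun y : Euc n => ⟪x, y⟫)).bddAbove
    (Set.mem_image_of_mem _ hy)

lemma supp_le {K : Set (Euc n)} (hK : K.Nonempty) {x : Euc n} {c : ℝ}
    (h : ∀ y ∈ K, ⟪x, y⟫ ≤ c) : supp K x ≤ c :=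
  csSup_le (hK.image _) (by rintro _ ⟨y, hy, rfl⟩; exact h y hy)

lemma exists_inner_eq_supp {K : Set (Euc n)} (hK : IsCompact K) (hne : K.Nonempty) (x : Euc n) :
    ∃ y ∈ K, ⟪x, y⟫ = supp K x := by
  obtain ⟨y, hy, hmax⟩ := hK.exists_isMaxOn hne
    (by fun_prop : Continuous fun y : Euc n => ⟪x, y⟫).continuousOn
  exact ⟨y, hy, le_antisymm (inner_le_supp hK x hy) (supp_le hne hmax)⟩

lemma supp_image (f : Euc n →ₗ[ℝ] Euc n) (K : Set (Euc n)) (x : Euc n) :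
    supp (f '' K) x = supp K (LinearMap.adjoint f x) := by
  simp only [supp, Set.image_image, LinearMap.adjoint_inner_left]

lemma supp_nonneg {K : Set (Euc n)} (hK : IsConvexBody0 K) (x : Euc n) : 0 ≤ supp K x := by
  simpa using inner_le_supp hK.1 x hK.2.2

lemma supp_add_le {K : Set (Euc n)} (hK : IsConvexBody0 K) (x y : Euc n) :
    supp K (x + y) ≤ supp K x + supp K y :=
  supp_le ⟨0, hK.2.2⟩ fun z hz => by
    rw [inner_add_left]
    exact add_le_add (inner_le_supp hK.1 x hz) (inner_le_supp hK.1 y hz)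

lemma supp_smul (K : Set (Euc n)) {t : ℝ} (ht : 0 ≤ t) (x : Euc n) :
    supp K (t • x) = t * supp K x := by
  rw [supp, supp, ← smul_eq_mul t, ← Real.sSup_smul_of_nonneg ht, ← Set.image_smul,
    Set.image_image]
  simp only [real_inner_smul_left, smul_eq_mul]

lemma continuous_supp {K : Set (Euc n)} (hK : IsCompact K) : Continuous (supp K) :=
  hK.continuous_sSup (f := fun x y : Euc n => (⟪x, y⟫ : ℝ))
    (by simp only [Function.HasUncurry.uncurry, id]; fun_prop)

lemma supp_set_add {K L : Set (Euc n)} (hK : IsConvexBody0 K) (hL : IsConvexBody0 L)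
    (x : Euc n) : supp (K + L) x = supp K x + supp L x := by
  have hKL : IsCompact (K + L) := hK.1.add hL.1
  refine le_antisymm (supp_le ⟨0 + 0, Set.add_mem_add hK.2.2 hL.2.2⟩ ?_) ?_
  · rintro _ ⟨y, hy, z, hz, rfl⟩
    rw [inner_add_right]
    exact add_le_add (inner_le_supp hK.1 x hy) (inner_le_supp hL.1 x hz)
  · obtain ⟨y, hy, e1⟩ := exists_inner_eq_supp hK.1 ⟨0, hK.2.2⟩ x
    obtain ⟨z, hz, e2⟩ := exists_inner_eq_supp hL.1 ⟨0, hL.2.2⟩ x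
    rw [← e1, ← e2, ← inner_add_right]
    exact inner_le_supp hKL x (Set.add_mem_add hy hz)

lemma isConvexBody0_add {K L : Set (Euc n)} (hK : IsConvexBody0 K) (hL : IsConvexBody0 L) :
    IsConvexBody0 (K + L) :=
  ⟨hK.1.add hL.1, hK.2.1.add hL.2.1, by simpa using Set.add_mem_add hK.2.2 hL.2.2⟩

lemma isConvexBody0_image {K : Set (Euc n)} (hK : IsConvexBody0 K) (f : Euc n →ₗ[ℝ] Euc n) :
    IsConvexBody0 (f '' K) :=
  ⟨hK.1.image f.continuous_of_finiteDimensional, hK.2.1.linear_image f, 0, hK.2.2, map_zero f⟩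

lemma subset_of_supp_le {K L : Set (Euc n)} (hK : IsConvexBody0 K) (hL : IsConvexBody0 L)
    (h : ∀ x, supp K x ≤ supp L x) : K ⊆ L := by
  intro x hx
  by_contra hxL
  obtain ⟨f, c, hfc, hcx⟩ := geometric_hahn_banach_closed_point hL.2.1 hL.1.isClosed hxL
  set y := (InnerProductSpace.toDual ℝ (Euc n)).symm f
  have hy : ∀ z, ⟪y, z⟫ = f z := fun z => InnerProductSpace.toDual_symm_apply
  have h1 := inner_le_supp hK.1 y hx
  have h2 : supp L y ≤ c := supp_le ⟨0, hL.2.2⟩ fun z hz => by rw [hy]; exact (hfc z hz).le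
  rw [hy] at h1
  linarith [h y]

/-- A convex body is determined by its support function. -/
lemma eq_of_supp_eq {K L : Set (Euc n)} (hK : IsConvexBody0 K) (hL : IsConvexBody0 L)
    (h : ∀ x, supp K x = supp L x) : K = L :=
  (subset_of_supp_le hK hL fun x => (h x).le).antisymm
    (subset_of_supp_le hL hK fun x => (h x).ge)

lemma supp_union_add_inter {K L : Set (Euc n)} (hK : IsConvexBody0 K) (hL : IsConvexBody0 L)
    (hU : IsConvexBody0 (K ∪ L)) (x : Euc n) :
    supp (K ∪ L) x + supp (K ∩ L) x = supp K x + supp L x := by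
  have hI : IsCompact (K ∩ L) := hK.1.inter hL.1
  have hne : (K ∩ L).Nonempty := ⟨0, hK.2.2, hL.2.2⟩
  have h1 : supp (K ∪ L) x = max (supp K x) (supp L x) := by
    refine le_antisymm (supp_le ⟨0, hU.2.2⟩ ?_) (max_le ?_ ?_)
    · rintro y (hy | hy)
      · exact le_max_of_le_left (inner_le_supp hK.1 x hy)
      · exact le_max_of_le_right (inner_le_supp hL.1 x hy)
    · exact supp_le ⟨0, hK.2.2⟩ fun y hy => inner_le_supp hU.1 x (Or.inl hy)
    · exact supp_le ⟨0, hL.2.2⟩ fun y hy => inner_le_supp hU.1 x (Or.inr hy)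
  have h2 : supp (K ∩ L) x = min (supp K x) (supp L x) := by
    refine le_antisymm (le_min ?_ ?_) ?_
    · exact supp_le hne fun y hy => inner_le_supp hK.1 x hy.1
    · exact supp_le hne fun y hy => inner_le_supp hL.1 x hy.2
    · obtain ⟨y, hy, e1⟩ := exists_inner_eq_supp hK.1 ⟨0, hK.2.2⟩ x
      obtain ⟨z, hz, e2⟩ := exists_inner_eq_supp hL.1 ⟨0, hL.2.2⟩ x
      obtain ⟨w, hw, hwK, hwL⟩ := isPreconnected_closed_iff.mp (convex_segment y z).isPreconnected
        K L hK.1.isClosed hL.1.isClosed (hU.2.1.segment_subset (Or.inl hy) (Or.inr hz))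
        ⟨y, left_mem_segment ℝ y z, hy⟩ ⟨z, right_mem_segment ℝ y z, hz⟩
      refine le_trans ?_ (inner_le_supp hI x ⟨hwK, hwL⟩)
      obtain ⟨a, b, ha, hb, hab, rfl⟩ := hw
      rw [inner_add_right, inner_smul_right, inner_smul_right, ← e1, ← e2]
      calc min ⟪x, y⟫ ⟪x, z⟫ = a * min ⟪x, y⟫ ⟪x, z⟫ + b * min ⟪x, y⟫ ⟪x, z⟫ := by
            rw [← add_mul, hab, one_mul]
        _ ≤ _ := add_le_add (mul_le_mul_of_nonneg_left (min_le_left _ _) ha)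
            (mul_le_mul_of_nonneg_left (min_le_right _ _) hb)
  rw [h1, h2, max_add_min]

lemma admissible_supp : Admissible (supp (n := n)) where
  val _ _ hK hL hU _ x := supp_union_add_inter (isConvexBody0_of_isPolytope0 hK)
    (isConvexBody0_of_isPolytope0 hL) (isConvexBody0_of_isPolytope0 hU) x
  cov f _ P _ x := supp_image f P x
  cont _ hP := continuous_supp (isCompact_of_isPolytope0 hP)
  hom P _ _ ht x := supp_smul P ht x

lemma supp_hullZero {u : Fin n → Euc n} {I : Finset (Fin n)} {x : Euc n} {c : ℝ} (hc : 0 ≤ c)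
    (h : ∀ i ∈ I, ⟪x, u i⟫ ≤ c) (h' : c = 0 ∨ ∃ i ∈ I, ⟪x, u i⟫ = c) :
    supp (hullZero u I) x = c := by
  have hP := isPolytope0_hullZero u I
  refine le_antisymm (supp_le ⟨0, hP.2⟩ fun y hy => ?_) ?_
  · obtain ⟨d, hd0, hdI, hd1, rfl⟩ := mem_hullZero.mp hy
    simp only [inner_sum, inner_smul_right]
    calc ∑ i, d i * ⟪x, u i⟫ ≤ ∑ i, d i * c := Finset.sum_le_sum fun i _ => by
          by_cases hi : i ∈ I
          · exact mul_le_mul_of_nonneg_left (h i hi) (hd0 i)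
          · simp [hdI i hi]
      _ = (∑ i, d i) * c := by rw [Finset.sum_mul]
      _ ≤ c := mul_le_of_le_one_left hc hd1
  · rcases h' with rfl | ⟨i, hi, rfl⟩
    · exact supp_nonneg (isConvexBody0_of_isPolytope0 hP) x
    · exact inner_le_supp (isCompact_of_isPolytope0 hP) x
        (subset_convexHull ℝ _ (Or.inr ⟨i, hi, rfl⟩))

lemma integrableOn_max_inner {K : Set (Euc n)} (hK : IsCompact K) (x : Euc n) :
    IntegrableOn (fun y => max ⟪x, y⟫ 0) K :=
  (by fun_prop : Continuous fun y : Euc n => max ⟪x, y⟫ 0).continuousOn.integrableOn_compact hK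

lemma mPlus1_nonneg (K : Set (Euc n)) (x : Euc n) : 0 ≤ mPlus1 K x :=
  integral_nonneg fun _ => le_max_right _ _

lemma mMinus1_eq (K : Set (Euc n)) (x : Euc n) : mMinus1 K x = mPlus1 K (-x) := by
  simp only [mMinus1, mPlus1, inner_neg_left]

lemma admissible_mPlus1 : Admissible (mPlus1 (n := n)) where
  val K L hK hL hU hI x := by
    have hi := fun {K : Set (Euc n)} (hK : IsPolytope0 K) =>
      integrableOn_max_inner (isCompact_of_isPolytope0 hK) x
    rw [mPlus1, mPlus1, mPlus1, mPlus1, ← integral_add_measure (hi hU) (hi hI),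
      ← integral_add_measure (hi hK) (hi hL),
      Measure.restrict_union_add_inter _ (isCompact_of_isPolytope0 hL).measurableSet]
  cov f hf P _ x := by
    have hdet : LinearMap.det f ≠ 0 := by rw [hf]; exact one_ne_zero
    have hmp : MeasurePreserving f (volume : Measure (Euc n)) volume :=
      ⟨f.continuous_of_finiteDimensional.measurable, by
        rw [Measure.map_linearMap_addHaar_eq_smul_addHaar _ hdet, hf]; simp⟩
    have hemb : MeasurableEmbedding f := by
      have hinj : Function.Injective f := (LinearMap.equivOfDetNeZero f hdet).injective
      exact f.continuous_of_finiteDimensional.measurableEmbedding hinj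
    simp only [mPlus1, hmp.setIntegral_image_emb hemb, LinearMap.adjoint_inner_left]
  cont P hP := continuous_parametric_integral_of_continuous
    (f := fun x y : Euc n => max ⟪x, y⟫ 0) (by fun_prop) (isCompact_of_isPolytope0 hP)
  hom P _ t ht x := by
    simp only [mPlus1]
    rw [← integral_const_mul]
    simp only [real_inner_smul_left, mul_max_of_nonneg _ _ ht, mul_zero]

lemma mPlus1_hullZero_of_ne_univ {u : Fin n → Euc n} {I : Finset (Fin n)}
    (hI : I ≠ Finset.univ) (x : Euc n) : mPlus1 (hullZero u I) x = 0 := by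
  refine setIntegral_measure_zero _ (measure_mono_null (t := (Submodule.span ℝ (u '' I) : Set _))
    ?_ (Measure.addHaar_submodule volume _ fun h => ?_))
  · refine convexHull_min ?_ (Submodule.convex _)
    exact Set.insert_subset (zero_mem _) Submodule.subset_span
  · classical
    have h1 := finrank_span_finset_le_card (R := ℝ) (I.image u)
    rw [Finset.coe_image, Set.finrank, h, finrank_top, finrank_euclideanSpace_fin] at h1
    have h2 : I.card < Fintype.card (Fin n) :=
      (Finset.card_lt_univ_of_notMem (not_forall.mp (mt Finset.eq_univ_iff_forall.mpr hI)).choose_spec)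
    rw [Fintype.card_fin] at h2
    exact absurd (h1.trans Finset.card_image_le) h2.not_ge

lemma mPlus1_eq_zero {K : Set (Euc n)} {x : Euc n}
    (h : ∀ y ∈ K, ⟪x, y⟫ ≤ 0) : mPlus1 K x = 0 :=
  setIntegral_eq_zero_of_forall_eq_zero fun y hy => max_eq_right (h y hy)

lemma mPlus1_std_pos (i : Fin n) :
    0 < mPlus1 (hullZero (EuclideanSpace.basisFun (Fin n) ℝ) Finset.univ)
      (EuclideanSpace.single i 1) := by
  set T := hullZero (EuclideanSpace.basisFun (Fin n) ℝ) Finset.univ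
  set U : Set (Euc n) := {y | (∀ j, 0 < y j) ∧ ∑ j, y j < 1} with hU
  have hUo : IsOpen U := by
    rw [hU, Set.ofPred_and, Set.ofPred_forall]
    refine (isOpen_iInter_of_finite fun j => ?_).inter ?_
    · exact isOpen_lt continuous_const (by fun_prop)
    · exact isOpen_lt (by fun_prop) continuous_const
  have hUn : U.Nonempty := by
    have hpos : (0 : ℝ) < n + 1 := by positivity
    refine ⟨WithLp.toLp 2 fun _ => 1 / ((n : ℝ) + 1), fun j => ?_, ?_⟩
    · show 0 < 1 / ((n : ℝ) + 1)
      positivity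
    · show ∑ _j : Fin n, 1 / ((n : ℝ) + 1) < 1
      rw [Finset.sum_const, Finset.card_univ, Fintype.card_fin, nsmul_eq_mul, mul_one_div,
        div_lt_one hpos]
      linarith
  refine (setIntegral_pos_iff_support_of_nonneg_ae
    (Eventually.of_forall fun _ => le_max_right _ _) (integrableOn_max_inner
      (isCompact_of_isPolytope0 (isPolytope0_hullZero _ _)) _)).mpr ?_
  refine lt_of_lt_of_le (hUo.measure_pos volume hUn) (measure_mono fun y hy => ⟨?_, ?_⟩)
  · rw [Function.mem_support, EuclideanSpace.inner_single_left]
    have := hy.1 i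
    simp only [map_one, one_mul]
    exact (lt_max_of_lt_left this).ne'
  · refine mem_hullZero.mpr ⟨fun j => y j, fun j => (hy.1 j).le, by simp, hy.2.le, ?_⟩
    ext k
    simp [Pi.single_apply]

lemma single_le_max (i k : Fin n) (s : ℝ) : (Pi.single i s : Fin n → ℝ) k ≤ max s 0 := by
  rw [Pi.single_apply]
  split_ifs
  · exact le_max_left _ _
  · exact le_max_right _ _

lemma supp_hullZero_of_inner_eq_single {u : Fin n → Euc n} {I : Finset (Fin n)} {x : Euc n}
    {i : Fin n} (hi : i ∈ I) {s : ℝ} (hx : ∀ k, ⟪x, u k⟫ = (Pi.single i s : Fin n → ℝ) k) :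
    supp (hullZero u I) x = max s 0 := by
  refine supp_hullZero (le_max_right _ _) (fun k _ => by rw [hx]; exact single_le_max i k s) ?_
  rcases le_total s 0 with h | h
  · exact Or.inl (max_eq_right h)
  · exact Or.inr ⟨i, hi, by rw [hx, Pi.single_eq_same, max_eq_left h]⟩

lemma low_supp {I : Finset (Fin n)} {i : Fin n} (hi : i ∈ I) (s : ℝ) :
    low supp I (Pi.single i s) = max s 0 :=
  supp_hullZero_of_inner_eq_single hi fun k => inner_toLp_std _ k

lemma low_comp_neg (g : Set (Euc n) → Euc n → ℝ) (I : Finset (Fin n)) (i : Fin n) (s : ℝ) :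
    low (fun P x => g P (-x)) I (Pi.single i s) = low g I (Pi.single i (-s)) := by
  simp only [low, ← WithLp.toLp_neg, Pi.single_neg]

lemma neg_inner_eq_single {u : Fin n → Euc n} {x : Euc n} {i : Fin n} {s : ℝ}
    (hx : ∀ k, ⟪x, u k⟫ = (Pi.single i s : Fin n → ℝ) k) (k : Fin n) :
    ⟪-x, u k⟫ = (Pi.single i (-s) : Fin n → ℝ) k := by
  rw [inner_neg_left, hx, Pi.single_neg, Pi.neg_apply]

lemma low_mPlus1 {I : Finset (Fin n)} (hI : I ≠ Finset.univ) (a : Fin n → ℝ) :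
    low mPlus1 I a = 0 :=
  mPlus1_hullZero_of_ne_univ hI _

lemma volumeLinear_mPlus1_neg (i : Fin n) : VolumeLinear mPlus1 i (-1) 0 := by
  intro u x _ hx
  rw [mul_zero]
  refine mPlus1_eq_zero fun y hy => ?_
  have := inner_le_supp (isCompact_of_isPolytope0 (isPolytope0_hullZero u Finset.univ)) x hy
  rw [supp_hullZero_of_inner_eq_single (Finset.mem_univ i) hx] at this
  simpa using this

lemma exists_volumeLinear_mPlus1 (hn : 4 ≤ n) {i₀ i₁ i₂ : Fin n} (h01 : i₀ ≠ i₁) (h02 : i₀ ≠ i₂)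
    (h12 : i₁ ≠ i₂) : ∃ θ, 0 < θ ∧ VolumeLinear mPlus1 i₀ 1 θ := by
  obtain ⟨θ, hθ⟩ := admissible_mPlus1.exists_volumeLinear (by omega) h01 h02 h12
    (fun _ => low_mPlus1 (fun h => by
      have := congrArg Finset.card h
      rw [Finset.card_singleton, Finset.card_univ, Fintype.card_fin] at this
      omega) _)
    (fun _ => low_mPlus1 (fun h => by
      have := congrArg Finset.card h
      rw [Finset.card_pair h01, Finset.card_univ, Fintype.card_fin] at this
      omega) _) 1 0 (fun _ _ _ _ => mPlus1_nonneg _ _)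
  refine ⟨θ, ?_, hθ⟩
  have h := hθ _ (WithLp.toLp 2 (Pi.single i₀ 1)) vol_std_ne_zero fun k => inner_toLp_std _ k
  rw [vol_std, abs_one, one_mul] at h
  rw [← h]
  exact mPlus1_std_pos i₀

lemma VolumeLinear.comp_neg {g : Set (Euc n) → Euc n → ℝ} {i : Fin n} {s θ : ℝ}
    (h : VolumeLinear g i (-s) θ) : VolumeLinear (fun P x => g P (-x)) i s θ :=
  fun u x hu hx => h u (-x) hu (neg_inner_eq_single hx)

lemma VolumeLinear.add_const_mul {g g' : Set (Euc n) → Euc n → ℝ} {i : Fin n} {s θ θ' : ℝ}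
    (h : VolumeLinear g i s θ) (h' : VolumeLinear g' i s θ') (c : ℝ) :
    VolumeLinear (fun P x => g P x + c * g' P x) i s (θ + c * θ') := fun u x hu hx => by
  simp only [h u x hu hx, h' u x hu hx]
  ring

/-- A volume-linear functional which is bounded below has a nonnegative slope. -/
lemma VolumeLinear.nonneg_of_bounded {g : Set (Euc n) → Euc n → ℝ} {i : Fin n} {s θ C : ℝ}
    (h : VolumeLinear g i s θ) (hC : ∀ (u : Fin n → Euc n) (x : Euc n), vol n u ≠ 0 →
      (∀ k, ⟪x, u k⟫ = (Pi.single i s : Fin n → ℝ) k) → C ≤ g (hullZero u Finset.univ) x) :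
    0 ≤ θ := by
  by_contra! hθ
  set V : ℝ := (|C| + 1) / -θ with hV
  have hVpos : 0 < V := div_pos (by positivity) (by linarith)
  set E : Fin n → Euc n := ⇑(EuclideanSpace.basisFun (Fin n) ℝ) with hE
  have hvol : vol n (Function.update E i (V • E i)) = V := by
    rw [vol_update_smul, vol_std, mul_one]
  have hne : vol n (Function.update E i (V • E i)) ≠ 0 := by rw [hvol]; exact hVpos.ne'
  obtain ⟨x, hx⟩ := exists_inner_eq hne (Pi.single i s)
  have h1 := hC _ x hne hx
  rw [h _ x hne hx, hvol, abs_of_pos hVpos] at h1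
  have h2 : V * θ = -(|C| + 1) := by
    have := hθ.ne
    rw [hV]
    field_simp
  have := neg_abs_le C
  linarith

/-- The classification of nonnegative sublinear admissible functionals. -/
theorem Admissible.exists_constants {h : Set (Euc n) → Euc n → ℝ} (hh : Admissible h) (hn : 4 ≤ n)
    (hsub : ∀ P, IsPolytope0 P → ∀ x y, h P (x + y) ≤ h P x + h P y)
    (hnn : ∀ P, IsPolytope0 P → ∀ x, 0 ≤ h P x) :
    ∃ c₁ c₂ c₃ c₄ : ℝ, 0 ≤ c₁ ∧ 0 ≤ c₂ ∧ 0 ≤ c₃ ∧ 0 ≤ c₄ ∧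
      ∀ P : Set (Euc n), IsPolytope0 P → ∀ x : Euc n,
        h P x = c₁ * mPlus1 P x + c₂ * mMinus1 P x + c₃ * supp P x + c₄ * supp P (-x) := by
  have hn2 : 2 ≤ n := by omega
  set i₀ : Fin n := ⟨0, by omega⟩ with hi₀
  set i₁ : Fin n := ⟨1, by omega⟩ with hi₁
  set i₂ : Fin n := ⟨2, by omega⟩ with hi₂
  set i₃ : Fin n := ⟨3, by omega⟩ with hi₃
  have h01 : i₀ ≠ i₁ := by simp [hi₀, hi₁]
  have h02 : i₀ ≠ i₂ := by simp [hi₀, hi₂]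
  have h03 : i₀ ≠ i₃ := by simp [hi₀, hi₃]
  have h12 : i₁ ≠ i₂ := by simp [hi₁, hi₂]
  have h13 : i₁ ≠ i₃ := by simp [hi₁, hi₃]
  have h23 : i₂ ≠ i₃ := by simp [hi₂, hi₃]
  have hb : low h {i₀, i₁} (Pi.single i₀ 1) = low h {i₀} (Pi.single i₀ 1) :=
    hh.low_pair_eq_low_singleton hn2 hsub hnn h01 h02 h03 h12 h13 h23
  have ha : low h {i₀, i₁} (Pi.single i₀ (-1)) = low h {i₀} (Pi.single i₀ (-1)) := by
    have := hh.comp_neg.low_pair_eq_low_singleton hn2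
      (fun P hP x y => by rw [neg_add]; exact hsub P hP _ _) (fun P hP x => hnn P hP _)
      h01 h02 h03 h12 h13 h23
    rwa [low_comp_neg, low_comp_neg] at this
  set b := low h {i₀} (Pi.single i₀ 1) with hbdef
  set a := low h {i₀} (Pi.single i₀ (-1)) with hadef
  have hb0 : 0 ≤ b := hnn _ (isPolytope0_hullZero _ _) _
  have ha0 : 0 ≤ a := hnn _ (isPolytope0_hullZero _ _) _
  set D₀ : Set (Euc n) → Euc n → ℝ := fun P x => h P x + -b * supp P x + -a * supp P (-x) with hD₀
  have hAD₀ : Admissible D₀ :=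
    (hh.add (admissible_supp.const_mul (-b))).add (admissible_supp.comp_neg.const_mul (-a))
  have hlow : ∀ (I : Finset (Fin n)), i₀ ∈ I → ∀ s, low D₀ I (Pi.single i₀ s) =
      low h I (Pi.single i₀ s) - b * max s 0 - a * max (-s) 0 := by
    intro I hI s
    have e1 := low_supp hI s
    have e2 := low_supp hI (-s)
    rw [← low_comp_neg] at e2
    rw [← e1, ← e2, hD₀]
    simp only [low]
    ring
  have hs : ∀ s, low D₀ {i₀} (Pi.single i₀ s) = 0 := hAD₀.low_single_smul
    (by rw [hlow _ (by simp)]; simp [← hbdef]) (by rw [hlow _ (by simp)]; simp [← hadef])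
  have ht : ∀ s, low D₀ {i₀, i₁} (Pi.single i₀ s) = 0 := hAD₀.low_single_smul
    (by rw [hlow _ (by simp), hb]; simp) (by rw [hlow _ (by simp), ha]; simp)
  have hbound : ∀ (s : ℝ) (u : Fin n → Euc n) (x : Euc n), vol n u ≠ 0 →
      (∀ k, ⟪x, u k⟫ = (Pi.single i₀ s : Fin n → ℝ) k) →
      -b * max s 0 + -a * max (-s) 0 ≤ D₀ (hullZero u Finset.univ) x := by
    intro s u x _ hx
    have := hnn _ (isPolytope0_hullZero u Finset.univ) x
    simp only [hD₀, supp_hullZero_of_inner_eq_single (Finset.mem_univ i₀) hx,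
      supp_hullZero_of_inner_eq_single (Finset.mem_univ i₀) (neg_inner_eq_single hx)]
    linarith
  obtain ⟨p, hp⟩ := hAD₀.exists_volumeLinear hn2 h01 h02 h12 hs ht 1 _ (hbound 1)
  obtain ⟨q, hq⟩ := hAD₀.exists_volumeLinear hn2 h01 h02 h12 hs ht (-1) _ (hbound (-1))
  have hp0 := hp.nonneg_of_bounded (hbound 1)
  have hq0 := hq.nonneg_of_bounded (hbound (-1))
  obtain ⟨θ, hθ0, hθ⟩ := exists_volumeLinear_mPlus1 hn h01 h02 h12
  have hθ' : VolumeLinear mPlus1 i₀ (-(-1)) θ := by rwa [neg_neg]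
  refine ⟨p / θ, q / θ, b, a, by positivity, by positivity, hb0, ha0, fun P hP x => ?_⟩
  set D : Set (Euc n) → Euc n → ℝ := fun P x =>
    D₀ P x + -(p / θ) * mPlus1 P x + -(q / θ) * mPlus1 P (-x) with hD
  have hAD : Admissible D := (hAD₀.add (admissible_mPlus1.const_mul (-(p / θ)))).add
    (admissible_mPlus1.comp_neg.const_mul (-(q / θ)))
  have hv1 : VolumeLinear D i₀ 1 0 := by
    have := (hp.add_const_mul hθ (-(p / θ))).add_const_mul
      (volumeLinear_mPlus1_neg i₀).comp_neg (-(q / θ))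
    convert this using 1
    field_simp
    ring
  have hv2 : VolumeLinear D i₀ (-1) 0 := by
    have := (hq.add_const_mul (volumeLinear_mPlus1_neg i₀) (-(p / θ))).add_const_mul
      hθ'.comp_neg (-(q / θ))
    convert this using 1
    field_simp
    ring
  have hlowD : ∀ (I : Finset (Fin n)), I.card < 4 → ∀ s,
      low D I (Pi.single i₀ s) = low D₀ I (Pi.single i₀ s) := by
    intro I hI s
    have hIu : I ≠ Finset.univ := by
      rintro rfl
      rw [Finset.card_univ, Fintype.card_fin] at hI
      omega
    simp only [low, hD, mPlus1_hullZero_of_ne_univ hIu, mul_zero, add_zero]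
  have hval : IsValuation0 fun P => D P x := fun K L hK hL hU hI => hAD.val K L hK hL hU hI x
  have hzero := hval.eq_zero (fun u I hu => hAD.hullZero_eq_zero_of_normalized hn2 h01
    (fun s => by rw [hlowD _ (by simp), hs])
    (fun s => by rw [hlowD _ (Finset.card_le_two.trans_lt (by norm_num)), ht]) hv1 hv2 hu I x) hP
  simp only [hD, hD₀] at hzero
  rw [mMinus1_eq]
  linarith

/-- The linear maps of determinant one are the actions of `SL(n)`. -/
lemma exists_specialLinearGroup {f : Euc n →ₗ[ℝ] Euc n} (hf : LinearMap.det f = 1) :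
    ∃ φ : Matrix.SpecialLinearGroup (Fin n) ℝ,
      Matrix.toEuclideanLin (φ : Matrix (Fin n) (Fin n) ℝ) = f := by
  refine ⟨⟨Matrix.toEuclideanLin.symm f, ?_⟩, LinearEquiv.apply_symm_apply _ _⟩
  rw [← hf, ← LinearMap.det_toLin (EuclideanSpace.basisFun (Fin n) ℝ).toBasis,
    ← Matrix.toEuclideanLin_eq_toLin_orthonormal, LinearEquiv.apply_symm_apply]

lemma det_toEuclideanLin (φ : Matrix.SpecialLinearGroup (Fin n) ℝ) :
    LinearMap.det (Matrix.toEuclideanLin (φ : Matrix (Fin n) (Fin n) ℝ)) = 1 := by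
  rw [Matrix.toEuclideanLin_eq_toLin_orthonormal, LinearMap.det_toLin]
  exact φ.2

lemma isPolytope0_image {P : Set (Euc n)} (hP : IsPolytope0 P) (f : Euc n →ₗ[ℝ] Euc n) :
    IsPolytope0 (f '' P) := by
  obtain ⟨⟨S, rfl⟩, h0⟩ := hP
  rw [LinearMap.image_convexHull]
  refine isPolytope0_convexHull (S.finite_toSet.image f) ?_
  rw [← LinearMap.image_convexHull]
  exact ⟨0, h0, map_zero f⟩

lemma admissible_supp_comp {Z : Set (Euc n) → Set (Euc n)}
    (hbody : ∀ P, IsPolytope0 P → IsConvexBody0 (Z P)) (hval : ValuationMink Z)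
    (hcov : SLCovariant Z) : Admissible fun P x => supp (Z P) x where
  val K L hK hL hU hI x := by
    rw [← supp_set_add (hbody _ hU) (hbody _ hI), hval K L hK hL hU hI,
      supp_set_add (hbody _ hK) (hbody _ hL)]
  cov f hf P hP x := by
    obtain ⟨φ, rfl⟩ := exists_specialLinearGroup hf
    have := hcov φ P hP
    simp only [matAct] at this
    rw [this, supp_image]
  cont P hP := continuous_supp (hbody P hP).1
  hom P _ t ht x := supp_smul (Z P) ht x

end MinkowskiClassification

/-- Theorem 1.6: for `n ≥ 4`, a map `Z : P_o^n → K_o^n` is an `SL(n)` covariant Minkowski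
valuation iff there are `c₁, c₂, c₃, c₄ ≥ 0` with `Z P = c₁ M⁺P + c₂ M⁻P + c₃ P + c₄ (-P)`
for every `P ∈ P_o^n` (stated via support functions). -/
theorem sln_covariant_Minkowski_classification (n : ℕ) (hn : 4 ≤ n)
    (Z : Set (Euc n) → Set (Euc n))
    (hbody : ∀ P : Set (Euc n), IsPolytope0 P → IsConvexBody0 (Z P)) :
    (ValuationMink Z ∧ SLCovariant Z) ↔
      ∃ c₁ c₂ c₃ c₄ : ℝ, 0 ≤ c₁ ∧ 0 ≤ c₂ ∧ 0 ≤ c₃ ∧ 0 ≤ c₄ ∧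
        ∀ P : Set (Euc n), IsPolytope0 P → ∀ x : Euc n,
          supp (Z P) x = c₁ * mPlus1 P x + c₂ * mMinus1 P x
            + c₃ * supp P x + c₄ * supp P (-x) := by
  open MinkowskiClassification in
  constructor
  · rintro ⟨hval, hcov⟩
    exact (admissible_supp_comp hbody hval hcov).exists_constants hn
      (fun P hP => supp_add_le (hbody P hP)) fun P hP => supp_nonneg (hbody P hP)
  · rintro ⟨c₁, c₂, c₃, c₄, -, -, -, -, h⟩
    have hA := (((admissible_mPlus1 (n := n)).const_mul c₁).add
      (admissible_mPlus1.comp_neg.const_mul c₂)).add ((admissible_supp.const_mul c₃).add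
      (admissible_supp.comp_neg.const_mul c₄))
    have hZ : ∀ P, IsPolytope0 P → ∀ x, supp (Z P) x = c₁ * mPlus1 P x + c₂ * mPlus1 P (-x)
        + (c₃ * supp P x + c₄ * supp P (-x)) := fun P hP x => by
      rw [h P hP, mMinus1_eq, add_assoc]
    constructor
    · intro K L hK hL hU hI
      refine eq_of_supp_eq (isConvexBody0_add (hbody _ hU) (hbody _ hI))
        (isConvexBody0_add (hbody _ hK) (hbody _ hL)) fun x => ?_
      rw [supp_set_add (hbody _ hU) (hbody _ hI), supp_set_add (hbody _ hK) (hbody _ hL),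
        hZ _ hU, hZ _ hI, hZ _ hK, hZ _ hL]
      exact hA.val K L hK hL hU hI x
    · intro φ P hP
      have hP' := isPolytope0_image hP (Matrix.toEuclideanLin (φ : Matrix (Fin n) (Fin n) ℝ))
      refine eq_of_supp_eq (hbody _ hP') (isConvexBody0_image (hbody _ hP) _) fun x => ?_
      rw [matAct, matAct, supp_image, hZ _ hP', hZ _ hP]
      exact hA.cov _ (det_toEuclideanLin φ) P hP x
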